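/- Let F = ℚ(√d) with d ≥ 6 squarefree and let H be a totally definite quaternion F-algebra. Then t(H, D₃†) = 1 if H is F-isomorphic to (−1,−3/F) and 3ε ∉ F^{×2}; otherwise t(H, D₃†) = 0. -/

import Mathlib

open NumberField Quaternion

noncomputable section

namespace QuatPaper

variable (F : Type) [Field F] [NumberField F]

def scalarSet (H : Type) [Ring H] [Algebra F H] : Set H :=
  Set.range fun r : 𝓞 F => algebraMap F H (algebraMap (𝓞 F) F r)

def IsOrder {H : Type} [Ring H] [Algebra F H] (O : Subring H) : Prop :=
  scalarSet F H ⊆ ↑O ∧ O.toAddSubgroup.FG ∧ Submodule.span F (O : Set H) = ⊤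

def IsMaximalOrder {H : Type} [Ring H] [Algebra F H] (O : Subring H) : Prop :=
  IsOrder F O ∧ ∀ O' : Subring H, IsOrder F O' → O ≤ O' → O' = O

def IsScalarUnit {H : Type} [Ring H] [Algebra F H] {O : Subring H} (u : (↥O)ˣ) : Prop :=
  ∃ r : (𝓞 F)ˣ, ((u : ↥O) : H) = algebraMap F H (algebraMap (𝓞 F) F ↑r)

def RedUnitIso {H : Type} [Ring H] [Algebra F H] (O : Subring H) (G : Type*) [Group G] : Prop :=
  ∃ φ : (↥O)ˣ →* G, Function.Surjective φ ∧ ∀ u, φ u = 1 ↔ IsScalarUnit F u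

def IsConjugate {H : Type} [Ring H] (x : Hˣ) (O O' : Subring H) : Prop :=
  ∀ y : H, y ∈ O ↔ (x : H) * y * ((x⁻¹ : Hˣ) : H) ∈ O'

def ConjRel {H : Type} [Ring H] (O O' : Subring H) : Prop :=
  ∃ x : Hˣ, IsConjugate x O O'

def typeNum (H : Type) [Ring H] [Algebra F H] (G : Type*) [Group G] : ℕ :=
  Nat.card (Quot fun O O' : {O : Subring H // IsMaximalOrder F O ∧ RedUnitIso F O G} =>
    ConjRel O.1 O'.1)

def IsQuatAlg (H : Type) [Ring H] [Algebra F H] : Prop :=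
  ∃ a b : F, a ≠ 0 ∧ b ≠ 0 ∧ Nonempty (H ≃ₐ[F] ℍ[F, a, b])

def TotallyDefinite (H : Type) [Ring H] [Algebra F H] : Prop :=
  ∀ σ : F →+* ℝ,
    letI : Algebra F ℝ := σ.toAlgebra
    ∀ x : TensorProduct F ℝ H, x ≠ 0 → IsUnit x

/-- The reduced norm `Nr(x) = x·x̄` of a quaternion `x ∈ ℍ[F, A, B]`. -/
def redNorm {A B : F} (x : ℍ[F, A, B]) : F := (x * star x).re

/-- The reduced unit group of `O` is isomorphic to the dihedral group `D_n` and is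
of the *first kind*: every element of order `2` in `O^×/O_F^×` admits a representative
whose reduced norm is the square of a unit of `O_F`. -/
def RedUnitDihedralFirstKind {A B : F} (n : ℕ) (O : Subring ℍ[F, A, B]) : Prop :=
  ∃ φ : (↥O)ˣ →* DihedralGroup n, Function.Surjective φ ∧
    (∀ u, φ u = 1 ↔ IsScalarUnit F u) ∧
    ∀ u : (↥O)ˣ, φ u ≠ 1 → φ u * φ u = 1 →
      ∃ u' : (↥O)ˣ, φ u' = φ u ∧ ∃ r : (𝓞 F)ˣ,
        redNorm F ((u' : ↥O) : ℍ[F, A, B]) = algebraMap (𝓞 F) F ↑r ^ 2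

/-- The reduced unit group of `O` is isomorphic to the dihedral group `D_n` and is
of the *second kind*: some element of order `2` in `O^×/O_F^×` has no representative
whose reduced norm is the square of a unit of `O_F`. -/
def RedUnitDihedralSecondKind {A B : F} (n : ℕ) (O : Subring ℍ[F, A, B]) : Prop :=
  ∃ φ : (↥O)ˣ →* DihedralGroup n, Function.Surjective φ ∧
    (∀ u, φ u = 1 ↔ IsScalarUnit F u) ∧
    ∃ u : (↥O)ˣ, φ u ≠ 1 ∧ φ u * φ u = 1 ∧
      ∀ u' : (↥O)ˣ, φ u' = φ u → ∀ r : (𝓞 F)ˣ,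
        redNorm F ((u' : ↥O) : ℍ[F, A, B]) ≠ algebraMap (𝓞 F) F ↑r ^ 2

/-- `t(H, D_n†)`: the number of conjugacy classes of maximal orders whose reduced unit
group is isomorphic to `D_n` of the first kind. -/
def typeNumDnFirstKind (A B : F) (n : ℕ) : ℕ :=
  Nat.card (Quot fun O O' : {O : Subring ℍ[F, A, B] //
      IsMaximalOrder F O ∧ RedUnitDihedralFirstKind F n O} => ConjRel O.1 O'.1)

/-- `t(H, D_n‡)`: the number of conjugacy classes of maximal orders whose reduced unit
group is isomorphic to `D_n` of the second kind. -/
def typeNumDnSecondKind (A B : F) (n : ℕ) : ℕ :=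
  Nat.card (Quot fun O O' : {O : Subring ℍ[F, A, B] //
      IsMaximalOrder F O ∧ RedUnitDihedralSecondKind F n O} => ConjRel O.1 O'.1)

/-- `ℵ(O₀)`: the number of maximal orders containing `O₀`. -/
def alephNum {H : Type} [Ring H] [Algebra F H] (O₀ : Subring H) : ℕ :=
  Nat.card {O : Subring H // IsMaximalOrder F O ∧ O₀ ≤ O}

/-- `ℶ(O₀)`: the number of orbits of the conjugation action of the normalizer
`N(O₀)` on the set of maximal orders containing `O₀`. -/
def bethNum {H : Type} [Ring H] [Algebra F H] (O₀ : Subring H) : ℕ :=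
  Nat.card (Quot fun O O' : {O : Subring H // IsMaximalOrder F O ∧ O₀ ≤ O} =>
    ∃ x : Hˣ, IsConjugate x O₀ O₀ ∧ IsConjugate x O.1 O'.1)

section

variable {F}

set_option linter.unusedSectionVars false

/-- `F = ℚ(s)` with `s² = d` for a squarefree `d ≥ 6`, with a real embedding making `s` positive. -/
structure IsRealQuad (d : ℕ) (s : F) (σ : F →+* ℝ) : Prop where
  six_le : 6 ≤ d
  sqf : Squarefree d
  sq : s ^ 2 = (d : F)
  gen : Algebra.adjoin ℚ {s} = ⊤
  pos : 0 < σ s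

theorem isIntegral_intCast (n : ℤ) : IsIntegral ℤ (n : F) := by
  simpa using isIntegral_algebraMap (R := ℤ) (A := F) (x := n)

theorem isIntegral_ratCast {q : ℚ} (h : IsIntegral ℤ (q : F)) : ∃ n : ℤ, q = n := by
  have h1 : IsIntegral ℤ q := by
    have : IsIntegral ℤ (algebraMap ℚ F q) := by simpa using h
    exact (isIntegral_algebraMap_iff (algebraMap ℚ F).injective).1 this
  obtain ⟨n, hn⟩ := IsIntegrallyClosed.isIntegral_iff.1 h1
  exact ⟨n, by simpa using hn.symm⟩

theorem not_isIntegral_third : ¬ IsIntegral ℤ (1 / 3 : F) := by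
  intro h
  obtain ⟨n, hn⟩ := isIntegral_ratCast (F := F) (q := 1 / 3) (by simpa using h)
  have : (1 : ℚ) = 3 * n := by rw [← hn]; norm_num
  have : (1 : ℤ) = 3 * n := by exact_mod_cast this
  omega

theorem int_of_sq_mul_squarefree {d : ℕ} (hd : Squarefree d) {q : ℚ} {k : ℤ}
    (h : (d : ℚ) * q ^ 2 = k) : ∃ n : ℤ, q = n := by
  have hd0 : (d : ℚ) ≠ 0 := by exact_mod_cast hd.ne_zero
  have h1 : (d : ℚ) * (q.num : ℚ) ^ 2 = k * (q.den : ℚ) ^ 2 := by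
    have hn : (q.num : ℚ) = q * q.den := (Rat.mul_den_eq_num q).symm
    rw [← h, hn]; ring
  have h2 : (d : ℤ) * q.num ^ 2 = k * (q.den : ℤ) ^ 2 := by exact_mod_cast h1
  have h3 : (q.den : ℤ) ^ 2 ∣ (d : ℤ) := by
    have hc : IsCoprime ((q.den : ℤ) ^ 2) (q.num ^ 2) := by
      apply IsCoprime.pow
      rw [Int.isCoprime_iff_gcd_eq_one, Int.gcd_comm]
      exact q.reduced
    exact hc.dvd_of_dvd_mul_right (Dvd.intro_left k h2.symm)
  have h4 : q.den * q.den ∣ d := by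
    have : ((q.den * q.den : ℕ) : ℤ) ∣ (d : ℤ) := by push_cast; rwa [← pow_two]
    exact_mod_cast this
  have h5 : q.den = 1 := Nat.isUnit_iff.1 (hd _ h4)
  exact ⟨q.num, by rw [← Rat.mul_den_eq_num, h5]; simp⟩

namespace IsRealQuad

variable {d : ℕ} {s : F} {σ : F →+* ℝ}

theorem sigma_sq (h : IsRealQuad d s σ) : σ s ^ 2 = d := by
  rw [← map_pow, h.sq]; simp

theorem ne_ratCast (h : IsRealQuad d s σ) (q : ℚ) : s ≠ q := by
  intro hs
  have h1 : (q : F) ^ 2 = (d : F) := by rw [← hs, h.sq]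
  have h2 : q ^ 2 = d := by exact_mod_cast h1
  obtain ⟨n, hn⟩ := int_of_sq_mul_squarefree h.sqf (q := q / d) (k := 1) (by
    have : (d : ℚ) ≠ 0 := by exact_mod_cast h.sqf.ne_zero
    field_simp; rw [h2]; push_cast; ring)
  have hd0 : (d : ℚ) ≠ 0 := by exact_mod_cast h.sqf.ne_zero
  have h3 : (d : ℚ) * n ^ 2 = 1 := by
    rw [← hn]; field_simp; rw [h2]
  have h4 : (d : ℤ) * n ^ 2 = 1 := by exact_mod_cast h3
  have := Int.isUnit_iff.1 (IsUnit.of_mul_eq_one _ h4)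
  have := h.six_le
  omega

theorem exists_rat (h : IsRealQuad d s σ) (x : F) : ∃ p q : ℚ, x = p + q * s := by
  have hx : x ∈ Algebra.adjoin ℚ {s} := by rw [h.gen]; trivial
  induction hx using Algebra.adjoin_induction with
  | mem y hy => exact ⟨0, 1, by simp [Set.mem_singleton_iff.1 hy]⟩
  | algebraMap r => exact ⟨r, 0, by simp⟩
  | add x y _ _ hx hy =>
    obtain ⟨p, q, rfl⟩ := hx
    obtain ⟨p', q', rfl⟩ := hy
    exact ⟨p + p', q + q', by push_cast; ring⟩
  | mul x y _ _ hx hy =>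
    obtain ⟨p, q, rfl⟩ := hx
    obtain ⟨p', q', rfl⟩ := hy
    refine ⟨p * p' + d * (q * q'), p * q' + q * p', ?_⟩
    push_cast
    linear_combination (q * q' : F) * h.sq

/-- The nontrivial automorphism of `F`. -/
theorem exists_conj (h : IsRealQuad d s σ) : ∃ c : F →ₐ[ℚ] F, c s = -s := by
  have hsInt : IsIntegral ℚ s := Algebra.IsIntegral.isIntegral s
  have hgen : Algebra.adjoin ℚ {s} = ⊤ := h.gen
  let pb := PowerBasis.ofAdjoinEqTop hsInt hgen
  have hg : pb.gen = s := by simp [pb]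
  have hroot : Polynomial.aeval (-s) (minpoly ℚ pb.gen) = 0 := by
    rw [hg]
    have hmin : minpoly ℚ s = Polynomial.X ^ 2 - Polynomial.C (d : ℚ) := by
      symm
      apply minpoly.unique' _ _ (Polynomial.monic_X_pow_sub_C _ (by norm_num))
      · simp [h.sq]
      · intro q hq
        have hq1 : q.natDegree ≤ 1 := by
          rw [Polynomial.degree_X_pow_sub_C (by norm_num)] at hq
          exact Polynomial.natDegree_le_of_degree_le (Order.le_of_lt_succ hq)
        obtain ⟨a, b, rfl⟩ := Polynomial.exists_eq_X_add_C_of_natDegree_le_one hq1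
        by_cases ha : a = 0
        · by_cases hb : b = 0
          · left; simp [ha, hb]
          · right; simpa [ha] using hb
        · right
          intro h0
          have ha' : (a : F) ≠ 0 := by exact_mod_cast ha
          apply h.ne_ratCast (-b / a)
          have h0 : (a : F) * s + b = 0 := by simpa using h0
          push_cast
          field_simp
          linear_combination h0
    rw [hmin]; simp [h.sq]
  exact ⟨pb.lift (-s) hroot, by
    have := pb.lift_gen (-s) hroot
    rwa [hg] at this⟩

theorem exists_int_of_isIntegral (h : IsRealQuad d s σ) {x : F} (hx : IsIntegral ℤ x) :
    ∃ m n k : ℤ, 2 * x = m + n * s ∧ m ^ 2 - d * n ^ 2 = 4 * k := by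
  obtain ⟨c, hc⟩ := h.exists_conj
  obtain ⟨p, q, hpq⟩ := h.exists_rat x
  have hcx : IsIntegral ℤ (c x) := hx.map (c.restrictScalars ℤ)
  have hcx' : c x = p - q * s := by
    rw [hpq, map_add, map_mul, hc, map_ratCast, map_ratCast]; ring
  obtain ⟨m, hm⟩ := isIntegral_ratCast (F := F) (q := 2 * p) (by
    have e : ((2 * p : ℚ) : F) = x + c x := by rw [hcx', hpq]; push_cast; ring
    rw [e]; exact hx.add hcx)
  obtain ⟨k', hk'⟩ := isIntegral_ratCast (F := F) (q := d * (2 * q) ^ 2) (by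
    have e : ((d * (2 * q) ^ 2 : ℚ) : F) = (x - c x) ^ 2 := by
      rw [hcx', hpq]; push_cast; rw [← h.sq]; ring
    rw [e]; exact (hx.sub hcx).pow 2)
  obtain ⟨n, hn⟩ := int_of_sq_mul_squarefree h.sqf hk'
  obtain ⟨k, hk⟩ := isIntegral_ratCast (F := F) (q := p ^ 2 - d * q ^ 2) (by
    have e : ((p ^ 2 - d * q ^ 2 : ℚ) : F) = x * c x := by
      rw [hcx', hpq]; push_cast; rw [← h.sq]; ring
    rw [e]; exact hx.mul hcx)
  refine ⟨m, n, k, ?_, ?_⟩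
  · have hm' : (2 * p : F) = m := by exact_mod_cast hm
    have hn' : (2 * q : F) = n := by exact_mod_cast hn
    rw [← hm', ← hn', hpq]; ring
  · have : (m : ℚ) ^ 2 - d * n ^ 2 = 4 * k := by rw [← hm, ← hn, ← hk]; ring
    exact_mod_cast this

theorem mul_squarefree_false {m d : ℕ} (hd : Squarefree d) (hm : 2 ≤ m) (h : m * m ∣ d) :
    False := by
  have := Nat.isUnit_iff.1 (hd m h)
  omega

theorem isIntegral_gen (h : IsRealQuad d s σ) : IsIntegral ℤ s := by
  refine IsIntegral.of_pow (n := 2) (by norm_num) ?_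
  rw [h.sq]
  exact_mod_cast isIntegral_intCast (F := F) d

/-- An algebraic integer of `F` all of whose conjugates lie in `[-2, 2]` is a rational integer. -/
theorem exists_int_of_sq_le_four (h : IsRealQuad d s σ) {x : F} (hx : IsIntegral ℤ x)
    (hb : ∀ ρ : F →+* ℝ, ρ x ^ 2 ≤ 4) : ∃ n : ℤ, x = n ∧ -2 ≤ n ∧ n ≤ 2 := by
  obtain ⟨m, n, k, h1, h2⟩ := h.exists_int_of_isIntegral hx
  obtain ⟨c, hc⟩ := h.exists_conj
  have hσ : ∀ ρ : F →+* ℝ, 2 * ρ x = m + n * ρ s := fun ρ => by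
    have := congrArg ρ h1
    rwa [map_mul, map_add, map_mul, map_ofNat, map_intCast, map_intCast] at this
  have b1 := hb σ
  have b2 := hb (σ.comp c)
  have e1 := hσ σ
  have e2 := hσ (σ.comp c)
  have hcs : (σ.comp (c : F →+* F)) s = - σ s := by simp [hc]
  rw [hcs] at e2
  have hs := h.sigma_sq
  have b1' : (m + n * σ s : ℝ) ^ 2 ≤ 16 := by rw [← e1]; linarith
  have b2' : (m + n * -σ s : ℝ) ^ 2 ≤ 16 := by rw [← e2]; linarith
  have b3 : (m : ℝ) ^ 2 + d * n ^ 2 ≤ 16 := by rw [← hs]; linarith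
  have b4 : (m : ℤ) ^ 2 + d * n ^ 2 ≤ 16 := by exact_mod_cast b3
  have h6 : (6 : ℤ) ≤ d := by exact_mod_cast h.six_le
  have hn1 : n ^ 2 ≤ 2 := by nlinarith [sq_nonneg m, sq_nonneg n]
  have hn2 : -1 ≤ n ∧ n ≤ 1 := by constructor <;> nlinarith
  have hn0 : n = 0 := by
    by_contra hn
    have hnn : n ^ 2 = 1 := by
      rcases hn2 with ⟨_, _⟩
      interval_cases n <;> simp_all
    rw [hnn] at b4 h2
    have hmle : -3 ≤ m ∧ m ≤ 3 := by constructor <;> nlinarith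
    have hd16 : (d : ℤ) ≤ 16 := by nlinarith [sq_nonneg m]
    have hnn' : (n : ℝ) ^ 2 = 1 := by exact_mod_cast hnn
    have hn' : (n : ℝ) = 1 ∨ (n : ℝ) = -1 := by
      have : ((n : ℝ) - 1) * (n + 1) = 0 := by linear_combination hnn'
      rcases mul_eq_zero.1 this with h | h
      · left; linarith
      · right; linarith
    have b5 : 2 * |(m : ℝ)| * σ s ≤ 16 - m ^ 2 - d := by
      rw [← hs]
      rcases abs_cases (m : ℝ) with ⟨ha, _⟩ | ⟨ha, _⟩ <;> rw [ha] <;>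
      rcases hn' with hn' | hn' <;> rw [hn'] at b1' b2' <;> nlinarith
    have hd4 : (d : ℤ) % 4 ≠ 0 := fun h4 =>
      mul_squarefree_false h.sqf (le_refl 2) (by omega)
    have hd9 : (d : ℤ) ≠ 9 := fun h9 =>
      mul_squarefree_false (m := 3) h.sqf (by norm_num) (by omega)
    have h24 : 2 < σ s := by
      have : (6 : ℝ) ≤ d := by exact_mod_cast h.six_le
      nlinarith [h.pos]
    have b6 : 4 * |(m : ℝ)| ≤ 16 - m ^ 2 - d := by
      nlinarith [abs_nonneg (m : ℝ)]
    have b7 : 4 * |m| ≤ 16 - m ^ 2 - d := by exact_mod_cast b6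
    obtain ⟨hm1, hm2⟩ := hmle
    interval_cases m <;> norm_num at b7 h2 <;> omega
  rw [hn0] at h1 h2
  have hm : Even m := by
    have : Even (m ^ 2) := ⟨2 * k, by linarith⟩
    exact (Int.even_pow.1 this).1
  obtain ⟨r, rfl⟩ := hm
  have hr : r ^ 2 ≤ 4 := by rw [hn0] at b4; linarith
  refine ⟨r, ?_, by nlinarith, by nlinarith⟩
  push_cast at h1
  linear_combination h1 / 2

theorem exists_residue (h : IsRealQuad d s σ) {x : F} (hx : IsIntegral ℤ x) :
    ∃ m n : ℤ, ∃ y : F, IsIntegral ℤ y ∧ x = m + n * s + 3 * y := by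
  obtain ⟨m, n, -, h1, -⟩ := h.exists_int_of_isIntegral hx
  refine ⟨-m, -n, x, hx, ?_⟩
  push_cast
  linear_combination -h1

theorem eq_zero_of_add_mul_eq_zero (h : IsRealQuad d s σ) {a b : ℚ} (hab : (a : F) + b * s = 0) :
    a = 0 ∧ b = 0 := by
  have hb : b = 0 := by
    by_contra hb
    have hb' : (b : F) ≠ 0 := by exact_mod_cast hb
    apply h.ne_ratCast (-a / b)
    push_cast
    field_simp
    linear_combination hab
  refine ⟨?_, hb⟩
  rw [hb] at hab
  simpa using hab

theorem three_dvd_of_isIntegral (h : IsRealQuad d s σ) {m n : ℤ}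
    (hx : IsIntegral ℤ ((m + n * s) / 3 : F)) : (3 : ℤ) ∣ m ∧ (3 : ℤ) ∣ n := by
  obtain ⟨m', n', -, h1, -⟩ := h.exists_int_of_isIntegral hx
  obtain ⟨e1, e2⟩ := h.eq_zero_of_add_mul_eq_zero (a := 2 * m - 3 * m') (b := 2 * n - 3 * n') (by
    push_cast; linear_combination 3 * h1)
  have e1' : 2 * m - 3 * m' = 0 := by exact_mod_cast e1
  have e2' : 2 * n - 3 * n' = 0 := by exact_mod_cast e2
  omega

theorem three_not_square (h : IsRealQuad d s σ) (t : F) : t ^ 2 ≠ 3 := by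
  intro ht
  have hsInt : IsIntegral ℤ t := by
    refine IsIntegral.of_pow (n := 2) (by norm_num) ?_
    rw [ht]; exact_mod_cast isIntegral_intCast (F := F) 3
  obtain ⟨m, n, -, h1, -⟩ := h.exists_int_of_isIntegral hsInt
  obtain ⟨e1, e2⟩ := h.eq_zero_of_add_mul_eq_zero (a := m ^ 2 + d * n ^ 2 - 12) (b := 2 * m * n) (by
    push_cast; rw [← h.sq]; linear_combination 4 * ht - (2 * t + m + n * s) * h1)
  have e1' : m ^ 2 + d * n ^ 2 - 12 = 0 := by exact_mod_cast e1
  have e2' : 2 * m * n = 0 := by exact_mod_cast e2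
  have h6 : (6 : ℤ) ≤ d := by exact_mod_cast h.six_le
  rcases mul_eq_zero.1 e2' with hm | hn
  · have hm0 : m = 0 := by omega
    rw [hm0] at e1'
    have hn : n ^ 2 ≤ 2 := by nlinarith [sq_nonneg n]
    have : -1 ≤ n ∧ n ≤ 1 := by constructor <;> nlinarith
    obtain ⟨_, _⟩ := this
    have hd4 : (d : ℤ) % 4 ≠ 0 := fun h4 =>
      mul_squarefree_false h.sqf (le_refl 2) (by omega)
    interval_cases n <;> omega
  · rw [hn] at e1'
    have : -3 ≤ m ∧ m ≤ 3 := by constructor <;> nlinarith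
    obtain ⟨_, _⟩ := this
    interval_cases m <;> omega

/-- Every positive unit is a power of the fundamental unit. -/
theorem exists_zpow_eq {ε : (𝓞 F)ˣ} (hε : 1 < σ (algebraMap (𝓞 F) F ↑ε))
    (hεfund : ∀ u : (𝓞 F)ˣ, 1 < σ (algebraMap (𝓞 F) F ↑u) →
      σ (algebraMap (𝓞 F) F ↑ε) ≤ σ (algebraMap (𝓞 F) F ↑u))
    (u : (𝓞 F)ˣ) (hu : 0 < σ (algebraMap (𝓞 F) F ↑u)) : ∃ k : ℤ, u = ε ^ k := by
  let f : (𝓞 F)ˣ →* ℝˣ := Units.map (σ.comp (algebraMap (𝓞 F) F)).toMonoidHom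
  have hf : ∀ v : (𝓞 F)ˣ, ((f v : ℝˣ) : ℝ) = σ (algebraMap (𝓞 F) F ↑v) := fun v => rfl
  have hinj : Function.Injective f :=
    Units.map_injective (σ.injective.comp (FaithfulSMul.algebraMap_injective (𝓞 F) F))
  rw [← hf] at hu hε
  obtain ⟨k, hk1, hk2⟩ := exists_mem_Ico_zpow hu hε
  refine ⟨k, ?_⟩
  have hpos : 0 < ((f ε : ℝˣ) : ℝ) ^ k := zpow_pos (by linarith) k
  have hv : ((f (u * (ε ^ k)⁻¹) : ℝˣ) : ℝ) = f u / (f ε : ℝ) ^ k := by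
    rw [map_mul, map_inv, map_zpow]; push_cast; rw [div_eq_mul_inv]
  have hv1 : ¬ 1 < ((f (u * (ε ^ k)⁻¹) : ℝˣ) : ℝ) := by
    intro h1
    have h2 := hεfund _ (by rwa [hf] at h1)
    rw [← hf, ← hf, hv, le_div_iff₀ hpos] at h2
    rw [zpow_add₀ (by linarith), zpow_one] at hk2
    linarith
  have hv2 : 1 ≤ ((f (u * (ε ^ k)⁻¹) : ℝˣ) : ℝ) := by
    rw [hv, le_div_iff₀ hpos]; linarith
  have hv3 : f (u * (ε ^ k)⁻¹) = 1 := by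
    ext; push_cast; linarith
  rw [← map_one f] at hv3
  exact mul_inv_eq_one.1 (hinj hv3)

/-- If `3 * ε` is not a square then no unit of `𝓞 F` has the form `3 * f ^ 2`. -/
theorem not_unit_three_sq (h : IsRealQuad d s σ)
    {ε : (𝓞 F)ˣ} (hε : 1 < σ (algebraMap (𝓞 F) F ↑ε))
    (hεfund : ∀ u : (𝓞 F)ˣ, 1 < σ (algebraMap (𝓞 F) F ↑u) →
      σ (algebraMap (𝓞 F) F ↑ε) ≤ σ (algebraMap (𝓞 F) F ↑u))
    (hsq : ¬ ∃ t : F, 3 * algebraMap (𝓞 F) F ↑ε = t ^ 2) (f : F) (hf : f ≠ 0)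
    (h1 : IsIntegral ℤ (3 * f ^ 2)) (h2 : IsIntegral ℤ (3 * f ^ 2)⁻¹) : False := by
  have hne : (3 * f ^ 2) ≠ 0 := mul_ne_zero (by norm_num) (pow_ne_zero _ hf)
  let u : (𝓞 F)ˣ := ⟨⟨3 * f ^ 2, h1⟩, ⟨(3 * f ^ 2)⁻¹, h2⟩,
    by ext; exact mul_inv_cancel₀ hne, by ext; exact inv_mul_cancel₀ hne⟩
  have hu : algebraMap (𝓞 F) F (u : 𝓞 F) = 3 * f ^ 2 := rfl
  have hσf : σ f ≠ 0 := by simpa using hf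
  obtain ⟨k, hk⟩ := exists_zpow_eq hε hεfund u (by
    rw [hu, map_mul, map_pow, map_ofNat]; positivity)
  let g : (𝓞 F)ˣ →* Fˣ := Units.map (algebraMap (𝓞 F) F).toMonoidHom
  have hg : ∀ v : (𝓞 F)ˣ, ((g v : Fˣ) : F) = algebraMap (𝓞 F) F ↑v := fun v => rfl
  have hk' : 3 * f ^ 2 = (algebraMap (𝓞 F) F (ε : 𝓞 F)) ^ k := by
    rw [← hu, ← hg, hk, map_zpow, Units.val_zpow_eq_zpow_val, hg]
  have he : algebraMap (𝓞 F) F (ε : 𝓞 F) ≠ 0 := by rw [← hg]; exact (g ε).ne_zero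
  generalize algebraMap (𝓞 F) F (ε : 𝓞 F) = e at *
  rcases Int.even_or_odd' k with ⟨r, rfl | rfl⟩
  · have h3 : 3 * f ^ 2 = (e ^ r) ^ 2 := by rw [hk', two_mul, zpow_add₀ he, pow_two]
    apply h.three_not_square (e ^ r / f)
    rw [div_pow, ← h3]
    field_simp
  · apply hsq
    refine ⟨3 * f / e ^ r, ?_⟩
    have : (e ^ r) ≠ 0 := zpow_ne_zero _ he
    have h3 : 3 * f ^ 2 = (e ^ r) ^ 2 * e := by
      rw [hk', zpow_add₀ he, zpow_one, two_mul, zpow_add₀ he, pow_two]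
    field_simp
    linear_combination -h3

/-- If `3 * ε` is a square then `3` ramifies, and a square root is a multiple of `s` modulo `3`. -/
theorem three_dvd_of_sq (h : IsRealQuad d s σ) {ε : (𝓞 F)ˣ} {t : F}
    (ht : 3 * algebraMap (𝓞 F) F ↑ε = t ^ 2) :
    3 ∣ d ∧ IsIntegral ℤ t ∧ IsIntegral ℤ (t * s / 3) := by
  have hεi : IsIntegral ℤ (algebraMap (𝓞 F) F (ε : 𝓞 F)) := RingOfIntegers.isIntegral_coe _
  have hεi' : IsIntegral ℤ (algebraMap (𝓞 F) F ((ε⁻¹ : (𝓞 F)ˣ) : 𝓞 F)) :=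
    RingOfIntegers.isIntegral_coe _
  have hεε : algebraMap (𝓞 F) F (ε : 𝓞 F) * algebraMap (𝓞 F) F ((ε⁻¹ : (𝓞 F)ˣ) : 𝓞 F) = 1 := by
    rw [← map_mul, Units.mul_inv, map_one]
  have hti : IsIntegral ℤ t := by
    refine IsIntegral.of_pow (n := 2) (by norm_num) ?_
    rw [← ht]
    exact (by exact_mod_cast isIntegral_intCast (F := F) 3 : IsIntegral ℤ (3 : F)).mul hεi
  generalize algebraMap (𝓞 F) F (ε : 𝓞 F) = e at *
  generalize algebraMap (𝓞 F) F ((ε⁻¹ : (𝓞 F)ˣ) : 𝓞 F) = e' at *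
  obtain ⟨m, n, y, hy, hres⟩ := h.exists_residue hti
  have hsi := h.isIntegral_gen
  obtain ⟨d1, d2⟩ := h.three_dvd_of_isIntegral (m := m ^ 2 + d * n ^ 2) (n := 2 * m * n) (by
    have e3 : (((m ^ 2 + d * n ^ 2 : ℤ) : F) + ((2 * m * n : ℤ) : F) * s) / 3
        = e - ((t + ((m : ℤ) : F) + ((n : ℤ) : F) * s)) * y := by
      push_cast; rw [← h.sq]; rw [hres] at ht ⊢; linear_combination -ht / 3
    rw [e3]
    exact hεi.sub (((hti.add (isIntegral_intCast m)).add
      ((isIntegral_intCast n).mul hsi)).mul hy))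
  have hmn : ¬ ((3 : ℤ) ∣ m ∧ (3 : ℤ) ∣ n) := by
    rintro ⟨⟨m', rfl⟩, ⟨n', rfl⟩⟩
    apply not_isIntegral_third (F := F)
    have e3 : (1 / 3 : F) = ((m' : F) + n' * s + y) ^ 2 * e' := by
      push_cast at hres
      have : t = 3 * ((m' : F) + n' * s + y) := by rw [hres]; ring
      rw [this] at ht
      linear_combination (- 1 / 3) * hεε + e' / 9 * ht
    rw [e3]
    exact ((((isIntegral_intCast m').add ((isIntegral_intCast n').mul hsi)).add hy).pow 2).mul hεi'
  have key : (3 : ℤ) ∣ d ∧ (3 : ℤ) ∣ m := by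
    have p3 : Prime (3 : ℤ) := Int.prime_three
    have hm : (3 : ℤ) ∣ m := by
      rcases p3.dvd_or_dvd d2 with h2 | hn
      · rcases p3.dvd_or_dvd h2 with h2 | h2
        · norm_num at h2
        · exact h2
      · exact p3.dvd_of_dvd_pow ((dvd_add_left ((hn.pow (by norm_num)).mul_left _)).1 d1)
    refine ⟨?_, hm⟩
    have h2 := (dvd_add_right (hm.pow (by norm_num : 2 ≠ 0))).1 d1
    rcases p3.dvd_or_dvd h2 with h2 | h2
    · exact h2
    · exact absurd ⟨hm, p3.dvd_of_dvd_pow h2⟩ hmn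
  obtain ⟨⟨d', hd'⟩, ⟨m', rfl⟩⟩ := key
  refine ⟨by omega, hti, ?_⟩
  have hdF : (d : F) = 3 * (d' : F) := by exact_mod_cast congrArg (Int.cast (R := F)) hd'
  have e3 : t * s / 3 = (m' : F) * s + n * d' + y * s := by
    rw [hres]; push_cast
    linear_combination (n / 3 : F) * h.sq + (n / 3 : F) * hdF
  rw [e3]
  exact (((isIntegral_intCast m').mul hsi).add ((isIntegral_intCast n).mul
    (isIntegral_intCast d'))).add (hy.mul hsi)

end IsRealQuad

section Quat

variable {A B : F}

theorem redNorm_eq (x : ℍ[F, A, B]) :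
    redNorm F x = x.re ^ 2 - A * x.imI ^ 2 - B * x.imJ ^ 2 + A * B * x.imK ^ 2 := by
  simp [redNorm]; ring

theorem redNorm_mul (x y : ℍ[F, A, B]) : redNorm F (x * y) = redNorm F x * redNorm F y := by
  simp only [redNorm_eq, QuaternionAlgebra.re_mul, QuaternionAlgebra.imI_mul,
    QuaternionAlgebra.imJ_mul, QuaternionAlgebra.imK_mul]
  ring

theorem redNorm_one : redNorm F (1 : ℍ[F, A, B]) = 1 := by simp [redNorm_eq]

theorem redNorm_algebraMap (r : F) : redNorm F (algebraMap F ℍ[F, A, B] r) = r ^ 2 := by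
  simp [redNorm_eq, QuaternionAlgebra.algebraMap_eq]

theorem mul_star_eq_redNorm (x : ℍ[F, A, B]) :
    x * star x = algebraMap F ℍ[F, A, B] (redNorm F x) := by
  rw [QuaternionAlgebra.mul_star_eq_coe]; rfl

theorem star_mul_eq_redNorm (x : ℍ[F, A, B]) :
    star x * x = algebraMap F ℍ[F, A, B] (redNorm F x) := by
  ext <;> simp [redNorm_eq, QuaternionAlgebra.algebraMap_eq] <;> ring

theorem mul_self_eq (x : ℍ[F, A, B]) :
    x * x = algebraMap F _ (2 * x.re) * x - algebraMap F _ (redNorm F x) := by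
  ext <;> simp [redNorm_eq, QuaternionAlgebra.algebraMap_eq] <;> ring

variable {σ : F →+* ℝ}

theorem sq_re_le_redNorm (hA : σ A < 0) (hB : σ B < 0) (x : ℍ[F, A, B]) :
    σ x.re ^ 2 ≤ σ (redNorm F x) := by
  rw [redNorm_eq]
  simp only [map_add, map_sub, map_mul, map_pow]
  have := mul_pos_of_neg_of_neg hA hB
  nlinarith [mul_nonneg (neg_pos.2 hA).le (sq_nonneg (σ x.imI)),
    mul_nonneg (neg_pos.2 hB).le (sq_nonneg (σ x.imJ)), mul_nonneg this.le (sq_nonneg (σ x.imK))]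

theorem redNorm_ne_zero (hA : σ A < 0) (hB : σ B < 0) {x : ℍ[F, A, B]} (hx : x ≠ 0) :
    redNorm F x ≠ 0 := by
  intro h
  apply hx
  have hs : σ (redNorm F x) = 0 := by rw [h, map_zero]
  rw [redNorm_eq] at hs
  simp only [map_add, map_sub, map_mul, map_pow] at hs
  have hAB := mul_pos_of_neg_of_neg hA hB
  have h1 := mul_nonneg (neg_pos.2 hA).le (sq_nonneg (σ x.imI))
  have h2 := mul_nonneg (neg_pos.2 hB).le (sq_nonneg (σ x.imJ))
  have h3 := mul_nonneg hAB.le (sq_nonneg (σ x.imK))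
  have h4 := sq_nonneg (σ x.re)
  have e1 : σ x.re ^ 2 = 0 := by linarith
  have e2 : -σ A * σ x.imI ^ 2 = 0 := by linarith
  have e3 : -σ B * σ x.imJ ^ 2 = 0 := by linarith
  have e4 : σ A * σ B * σ x.imK ^ 2 = 0 := by linarith
  ext
  · simpa using e1
  · simpa [hA.ne] using e2
  · simpa [hB.ne] using e3
  · simpa [hA.ne, hB.ne] using e4

theorem isUnit_of_ne_zero (hA : σ A < 0) (hB : σ B < 0) {x : ℍ[F, A, B]} (hx : x ≠ 0) :
    IsUnit x := by
  have hn := redNorm_ne_zero hA hB hx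
  refine isUnit_iff_exists.2 ⟨star x * algebraMap F _ (redNorm F x)⁻¹, ?_, ?_⟩
  · rw [← mul_assoc, mul_star_eq_redNorm, ← map_mul, mul_inv_cancel₀ hn, map_one]
  · rw [← Algebra.commutes, mul_assoc, star_mul_eq_redNorm, ← map_mul, inv_mul_cancel₀ hn, map_one]

theorem mul_eq_zero_of_definite (hA : σ A < 0) (hB : σ B < 0) {x y : ℍ[F, A, B]} (h : x * y = 0) :
    x = 0 ∨ y = 0 := by
  by_contra! hc
  exact hc.2 (((isUnit_of_ne_zero hA hB hc.1).mul_right_eq_zero).1 h)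

theorem algebraMap_inj' {a b : F} (h : algebraMap F ℍ[F, A, B] a = algebraMap F _ b) : a = b :=
  QuaternionAlgebra.algebraMap_injective h

/-- An element whose square is `-1` has reduced norm `1`. -/
theorem redNorm_eq_one_of_sq (hA : σ A < 0) (hB : σ B < 0) {x : ℍ[F, A, B]} (hx : x * x = -1) :
    redNorm F x = 1 := by
  have h1 : redNorm F x * redNorm F x = 1 := by
    rw [← redNorm_mul, hx]; simp [redNorm_eq]
  rcases mul_self_eq_one_iff.1 h1 with h | h
  · exact h
  · have := sq_re_le_redNorm hA hB x
    rw [h, map_neg, map_one] at this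
    nlinarith [sq_nonneg (σ x.re)]

theorem isIntegral_of_algebraMap {r : F} (h : IsIntegral ℤ (algebraMap F ℍ[F, A, B] r)) :
    IsIntegral ℤ r := by
  obtain ⟨f, hf, h0⟩ := h
  refine ⟨f, hf, ?_⟩
  have h1 : Polynomial.aeval (algebraMap F ℍ[F, A, B] r) f = 0 := h0
  rw [Polynomial.aeval_algebraMap_apply] at h1
  exact (map_eq_zero_iff _ QuaternionAlgebra.algebraMap_injective).1 h1

open Polynomial in
/-- The reduced trace and reduced norm of an integral element are integral. -/
theorem isIntegral_trace_norm {x : ℍ[F, A, B]} (h : IsIntegral ℤ x) :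
    IsIntegral ℤ (2 * x.re) ∧ IsIntegral ℤ (redNorm F x) := by
  by_cases hx : ∃ r : F, x = algebraMap F _ r
  · obtain ⟨r, rfl⟩ := hx
    have hr := isIntegral_of_algebraMap h
    rw [redNorm_algebraMap]
    refine ⟨?_, hr.pow 2⟩
    have : 2 * (algebraMap F ℍ[F, A, B] r).re = r + r := by
      rw [QuaternionAlgebra.algebraMap_eq]; ring
    rw [this]; exact hr.add hr
  obtain ⟨f, hf, h0⟩ := h
  have h1 : aeval x (f.map (algebraMap ℤ F)) = 0 := by
    rw [aeval_map_algebraMap]; exact h0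
  let g : F[X] := X ^ 2 - C (2 * x.re) * X + C (redNorm F x)
  have hgdeg : g.natDegree = 2 := by
    simp only [g]; compute_degree!
  have hg : g.Monic := by
    simp only [g]; monicity!
  have hgx : aeval x g = 0 := by
    simp only [g, map_add, map_sub, map_mul, aeval_X, aeval_C, pow_two, mul_self_eq x]
    simp
  have hdvd : g ∣ f.map (algebraMap ℤ F) := by
    rw [← modByMonic_eq_zero_iff_dvd hg]
    have hr : aeval x (f.map (algebraMap ℤ F) %ₘ g) = 0 := by
      have h2 := congrArg (aeval x) (modByMonic_add_div (f.map (algebraMap ℤ F)) g)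
      rw [map_add, map_mul, hgx, zero_mul, add_zero, h1] at h2
      exact h2
    have hdeg : (f.map (algebraMap ℤ F) %ₘ g).natDegree ≤ 1 := by
      have := natDegree_modByMonic_lt (f.map (algebraMap ℤ F)) hg (by
        intro h; rw [h] at hgdeg; simp at hgdeg)
      omega
    obtain ⟨a, b, hab⟩ := exists_eq_X_add_C_of_natDegree_le_one hdeg
    rw [hab] at hr ⊢
    simp only [map_add, map_mul, aeval_X, aeval_C] at hr
    by_cases ha : a = 0
    · rw [ha] at hr ⊢
      simp only [map_zero, zero_mul, zero_add] at hr ⊢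
      rw [(map_eq_zero_iff _ QuaternionAlgebra.algebraMap_injective).1 hr, map_zero]
    · exfalso
      apply hx
      refine ⟨-b / a, ?_⟩
      have h3 : algebraMap F ℍ[F, A, B] a⁻¹ * (algebraMap F _ a * x + algebraMap F _ b) = 0 := by
        rw [hr, mul_zero]
      rw [mul_add, ← mul_assoc, ← map_mul, ← map_mul, inv_mul_cancel₀ ha, map_one, one_mul] at h3
      rw [eq_neg_of_add_eq_zero_left h3, ← map_neg]
      congr 1; field_simp
  have hl := integralClosure.mem_lifts_of_monic_of_dvd_map F hf hg hdvd
  rw [lifts_iff_coeff_lifts] at hl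
  obtain ⟨⟨t, ht⟩, ht'⟩ := hl 1
  obtain ⟨⟨n, hn⟩, hn'⟩ := hl 0
  have c1 : g.coeff 1 = - (2 * x.re) := by simp [g]
  have c0 : g.coeff 0 = redNorm F x := by simp [g]
  have e1 : t = - (2 * x.re) := by rw [← c1, ← ht']; rfl
  have e0 : n = redNorm F x := by rw [← c0, ← hn']; rfl
  constructor
  · have : IsIntegral ℤ (-t) := IsIntegral.neg ht
    rwa [e1, neg_neg] at this
  · have : IsIntegral ℤ n := hn
    rwa [e0] at this

end Quat

section Order

variable {H : Type} [Ring H] [Algebra F H]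

theorem IsOrder.isIntegral {O : Subring H} (hO : IsOrder F O) {x : H} (hx : x ∈ O) :
    IsIntegral ℤ x := by
  refine IsIntegral.of_mem_of_fg (subalgebraOfSubring O) ?_ x hx
  have := hO.2.1
  rw [Submodule.fg_iff_addSubgroup_fg]
  exact this

theorem IsOrder.algebraMap_mem {O : Subring H} (hO : IsOrder F O) {r : F} (hr : IsIntegral ℤ r) :
    algebraMap F H r ∈ O :=
  hO.1 ⟨⟨r, hr⟩, rfl⟩

end Order

section OrderQuat

variable {A B : F} {O : Subring ℍ[F, A, B]}

theorem IsOrder.trace_integral (hO : IsOrder F O) {x : ℍ[F, A, B]} (hx : x ∈ O) :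
    IsIntegral ℤ (2 * x.re) := (isIntegral_trace_norm (hO.isIntegral hx)).1

theorem IsOrder.redNorm_integral (hO : IsOrder F O) {x : ℍ[F, A, B]} (hx : x ∈ O) :
    IsIntegral ℤ (redNorm F x) := (isIntegral_trace_norm (hO.isIntegral hx)).2

theorem IsOrder.star_mem (hO : IsOrder F O) {x : ℍ[F, A, B]} (hx : x ∈ O) : star x ∈ O := by
  have : star x = algebraMap F _ (2 * x.re) - x := by
    ext <;> simp [QuaternionAlgebra.algebraMap_eq]; ring
  rw [this]
  exact O.sub_mem (hO.algebraMap_mem (hO.trace_integral hx)) hx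

theorem IsOrder.isScalarUnit (hO : IsOrder F O) {u : (↥O)ˣ} {r : F}
    (h : ((u : ↥O) : ℍ[F, A, B]) = algebraMap F _ r) : IsScalarUnit F u := by
  have h1 : ((u : ↥O) : ℍ[F, A, B]) * ((u⁻¹ : (↥O)ˣ) : ↥O) = 1 := by
    exact_mod_cast congrArg (Subtype.val) u.mul_inv
  have hr0 : r ≠ 0 := by
    rintro rfl
    rw [h, map_zero, zero_mul] at h1
    exact zero_ne_one h1
  have h2 : (((u⁻¹ : (↥O)ˣ) : ↥O) : ℍ[F, A, B]) = algebraMap F _ r⁻¹ := by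
    have := congrArg (algebraMap F ℍ[F, A, B] r⁻¹ * ·) h1
    simp only [h] at this
    rwa [← mul_assoc, ← map_mul, inv_mul_cancel₀ hr0, map_one, one_mul, mul_one] at this
  have i1 : IsIntegral ℤ r := isIntegral_of_algebraMap (h ▸ hO.isIntegral (u : ↥O).2)
  have i2 : IsIntegral ℤ r⁻¹ :=
    isIntegral_of_algebraMap (h2 ▸ hO.isIntegral ((u⁻¹ : (↥O)ˣ) : ↥O).2)
  exact ⟨⟨⟨r, i1⟩, ⟨r⁻¹, i2⟩, by ext; exact mul_inv_cancel₀ hr0,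
    by ext; exact inv_mul_cancel₀ hr0⟩, h⟩

theorem coe_mul_inv (u : (↥O)ˣ) :
    ((u : ↥O) : ℍ[F, A, B]) * ((u⁻¹ : (↥O)ˣ) : ↥O) = 1 := by
  exact_mod_cast congrArg (Subtype.val) u.mul_inv

theorem coe_inv_mul (u : (↥O)ˣ) :
    (((u⁻¹ : (↥O)ˣ) : ↥O) : ℍ[F, A, B]) * (u : ↥O) = 1 := by
  exact_mod_cast congrArg (Subtype.val) u.inv_mul

end OrderQuat

section Lattice

/-- The first of the coordinates `cp`, `cq`, `cp'`, `cq'` of a quaternion of `(-1,-3)` with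
respect to the basis `w, j⁻¹, iw, ij⁻¹`, where `w = (-1+j)/2`. -/
def cp (x : ℍ[F, -1, -3]) : F := -2 * x.re
/-- The coordinate of `j⁻¹`. -/
def cq (x : ℍ[F, -1, -3]) : F := -3 * (x.re + x.imJ)
/-- The coordinate of `iw`. -/
def cp' (x : ℍ[F, -1, -3]) : F := -2 * x.imI
/-- The coordinate of `ij⁻¹`. -/
def cq' (x : ℍ[F, -1, -3]) : F := -3 * (x.imI + x.imK)

theorem ext_coords {x y : ℍ[F, -1, -3]} (h1 : cp x = cp y) (h2 : cq x = cq y)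
    (h3 : cp' x = cp' y) (h4 : cq' x = cq' y) : x = y := by
  simp only [cp, cq, cp', cq'] at *
  have a := mul_left_cancel₀ (by norm_num : (-2 : F) ≠ 0) h1
  have b := mul_left_cancel₀ (by norm_num : (-3 : F) ≠ 0) h2
  have c := mul_left_cancel₀ (by norm_num : (-2 : F) ≠ 0) h3
  have e := mul_left_cancel₀ (by norm_num : (-3 : F) ≠ 0) h4
  ext
  · exact a
  · exact c
  · rw [a] at b; exact add_left_cancel b
  · rw [c] at e; exact add_left_cancel e

theorem cp_mul (x y : ℍ[F, -1, -3]) : cp (x * y) = cp x * cp y - (cp x * cq y + cq x * cp y)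
    + 2 * (cp' x * cp' y) - (cp' x * cq' y + cq' x * cp' y)
    + 2 * ((cq x * cq y + cq' x * cq' y) / 3) := by
  simp [cp, cq, cp', cq']; ring

theorem cp'_mul (x y : ℍ[F, -1, -3]) : cp' (x * y) = cp' x * cp y - 2 * (cp x * cp' y)
    + (cp x * cq' y + cq x * cp' y) - (cp' x * cq y + cq' x * cp y)
    - 2 * ((cq x * cq' y + cq' x * (-cq y)) / 3) := by
  simp [cp, cq, cp', cq']; ring

theorem cq_mul (x y : ℍ[F, -1, -3]) : cq (x * y) = -2 * cp x * cq y + -2 * cp y * cq x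
    + 2 * cp' x * cq' y + -2 * cp' y * cq' x
    + 3 * (cp x * cp y + cp' x * cp' y - cp' x * cq' y + (cq x * cq y + cq' x * cq' y) / 3) := by
  simp [cp, cq, cp', cq']; ring

theorem cq'_mul (x y : ℍ[F, -1, -3]) : cq' (x * y) = -2 * cp x * cq' y + -2 * cp y * cq' x
    + 2 * cp' x * (-cq y) + -2 * cp' y * (-cq x)
    + 3 * (cp' x * cp y - cp x * cp' y + cp x * cq' y
      - (cq x * cq' y + cq' x * (-cq y)) / 3) := by
  simp [cp, cq, cp', cq']; ring

/-- Closure properties of a relation on the coordinates of `j⁻¹` and `ij⁻¹` making the lattice it defines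
an order. -/
structure Good (P : F → F → Prop) : Prop where
  int : ∀ {a b}, P a b → IsIntegral ℤ a ∧ IsIntegral ℤ b
  add : ∀ {a b a' b'}, P a b → P a' b' → P (a + a') (b + b')
  smul : ∀ {c a b}, IsIntegral ℤ c → P a b → P (c * a) (c * b)
  rot : ∀ {a b}, P a b → P b (-a)
  iso : ∀ {a b a' b'}, P a b → P a' b' → IsIntegral ℤ ((a * a' + b * b') / 3)
  three : ∀ {a b}, IsIntegral ℤ a → IsIntegral ℤ b → P (3 * a) (3 * b)

theorem isIntegral_ofNat (n : ℕ) [n.AtLeastTwo] : IsIntegral ℤ (OfNat.ofNat n : F) := by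
  have := isIntegral_intCast (F := F) (OfNat.ofNat n)
  have e : ((OfNat.ofNat n : ℤ) : F) = OfNat.ofNat n := Int.cast_ofNat n
  rwa [e] at this

variable {P : F → F → Prop}

theorem Good.zero (h : Good P) : P 0 0 := by
  have := h.three isIntegral_zero isIntegral_zero
  rwa [mul_zero] at this

theorem Good.neg (h : Good P) {a b : F} (hab : P a b) : P (-a) (-b) := by
  have := h.smul (IsIntegral.neg isIntegral_one) hab
  rwa [neg_one_mul, neg_one_mul] at this

/-- The order of `(-1,-3)` defined by a good relation. -/
def latt (h : Good P) : Subring ℍ[F, -1, -3] where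
  carrier := {x | IsIntegral ℤ (cp x) ∧ IsIntegral ℤ (cp' x) ∧ P (cq x) (cq' x)}
  zero_mem' := by
    refine ⟨?_, ?_, ?_⟩ <;> simp [cp, cp', cq, cq', isIntegral_zero, h.zero]
  one_mem' := by
    have h1 := h.three (IsIntegral.neg isIntegral_one) isIntegral_zero
    refine ⟨?_, ?_, ?_⟩
    · simpa [cp] using isIntegral_ofNat (F := F) 2
    · simp [cp', isIntegral_zero]
    · simpa [cq, cq'] using h1
  add_mem' := by
    rintro x y ⟨hp, hp', hq⟩ ⟨kp, kp', kq⟩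
    have e1 : cp (x + y) = cp x + cp y := by simp [cp]; ring
    have e2 : cp' (x + y) = cp' x + cp' y := by simp [cp']; ring
    have e3 : cq (x + y) = cq x + cq y := by simp [cq]; ring
    have e4 : cq' (x + y) = cq' x + cq' y := by simp [cq']; ring
    refine ⟨?_, ?_, ?_⟩
    · rw [e1]; exact hp.add kp
    · rw [e2]; exact hp'.add kp'
    · rw [e3, e4]; exact h.add hq kq
  neg_mem' := by
    rintro x ⟨hp, hp', hq⟩
    have e1 : cp (-x) = - cp x := by simp [cp]
    have e2 : cp' (-x) = - cp' x := by simp [cp']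
    have e3 : cq (-x) = - cq x := by simp [cq]; ring
    have e4 : cq' (-x) = - cq' x := by simp [cq']; ring
    refine ⟨?_, ?_, ?_⟩
    · rw [e1]; exact hp.neg
    · rw [e2]; exact hp'.neg
    · rw [e3, e4]; exact h.neg hq
  mul_mem' := by
    rintro x y ⟨hp, hp', hq⟩ ⟨kp, kp', kq⟩
    have i2 := isIntegral_ofNat (F := F) 2
    have X := h.iso hq kq
    have X' := h.iso hq (h.rot kq)
    obtain ⟨i3, i4⟩ := h.int hq
    obtain ⟨j3, j4⟩ := h.int kq
    refine ⟨?_, ?_, ?_⟩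
    · rw [cp_mul]
      exact ((((hp.mul kp).sub ((hp.mul j3).add (i3.mul kp))).add (i2.mul (hp'.mul kp'))).sub
        ((hp'.mul j4).add (i4.mul kp'))).add (i2.mul X)
    · rw [cp'_mul]
      exact ((((hp'.mul kp).sub (i2.mul (hp.mul kp'))).add ((hp.mul j4).add (i3.mul kp'))).sub
        ((hp'.mul j3).add (i4.mul kp))).sub (i2.mul X')
    · rw [cq_mul, cq'_mul]
      refine h.add (h.add (h.add (h.add (h.smul (i2.neg.mul hp) kq) (h.smul (i2.neg.mul kp) hq))
        (h.smul (i2.mul hp') (h.rot kq))) (h.smul (i2.neg.mul kp') (h.rot hq))) (h.three ?_ ?_)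
      · exact (((hp.mul kp).add (hp'.mul kp')).sub (hp'.mul j4)).add X
      · exact (((hp'.mul kp).sub (hp.mul kp')).add (hp.mul j4)).sub X'

theorem mem_latt (h : Good P) {x : ℍ[F, -1, -3]} :
    x ∈ latt h ↔ IsIntegral ℤ (cp x) ∧ IsIntegral ℤ (cp' x) ∧ P (cq x) (cq' x) := Iff.rfl

/-- The element `w = (-1+j)/2` of order `3`. -/
def wQ : ℍ[F, -1, -3] := ⟨-1 / 2, 0, 1 / 2, 0⟩
/-- The element `i`. -/
def iQ : ℍ[F, -1, -3] := ⟨0, 1, 0, 0⟩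

theorem iQ_sq : (iQ : ℍ[F, -1, -3]) * iQ = -1 := by
  ext <;> simp [iQ]
theorem wQ_sq : (wQ : ℍ[F, -1, -3]) * wQ + wQ + 1 = 0 := by
  ext <;> simp [wQ] <;> ring
theorem iQ_wQ : (iQ : ℍ[F, -1, -3]) * wQ = wQ * wQ * iQ := by
  ext <;> simp [iQ, wQ] <;> ring

theorem wQ_mem_latt (h : Good P) : wQ ∈ latt h := by
  rw [mem_latt]
  have e1 : cp (wQ : ℍ[F, -1, -3]) = 1 := by simp [cp, wQ]; ring
  have e2 : cp' (wQ : ℍ[F, -1, -3]) = 0 := by simp [cp', wQ]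
  have e3 : cq (wQ : ℍ[F, -1, -3]) = 0 := by simp [cq, wQ]; ring
  have e4 : cq' (wQ : ℍ[F, -1, -3]) = 0 := by simp [cq', wQ]
  rw [e1, e2, e3, e4]
  exact ⟨isIntegral_one, isIntegral_zero, h.zero⟩

theorem iQ_mem_latt (h : Good P) : iQ ∈ latt h := by
  rw [mem_latt]
  have e1 : cp (iQ : ℍ[F, -1, -3]) = 0 := by simp [cp, iQ]
  have e2 : cp' (iQ : ℍ[F, -1, -3]) = -2 := by simp [cp', iQ]
  have e3 : cq (iQ : ℍ[F, -1, -3]) = 3 * 0 := by simp [cq, iQ]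
  have e4 : cq' (iQ : ℍ[F, -1, -3]) = 3 * (-1) := by simp [cq', iQ]
  rw [e1, e2, e3, e4]
  exact ⟨isIntegral_zero, (isIntegral_ofNat 2).neg, h.three isIntegral_zero isIntegral_one.neg⟩

/-- The integral coordinates of an element of a `latt`. -/
def coordsMap (h : Good P) : (latt h).toAddSubgroup →ₗ[ℤ] (Fin 4 → 𝓞 F) :=
  AddMonoidHom.toIntLinearMap
    { toFun := fun x => ![⟨cp x.1, x.2.1⟩, ⟨cp' x.1, x.2.2.1⟩, ⟨cq x.1, (h.int x.2.2.2).1⟩,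
        ⟨cq' x.1, (h.int x.2.2.2).2⟩]
      map_zero' := by
        ext i
        have e1 : cp (0 : ℍ[F, -1, -3]) = 0 := by simp [cp]
        have e2 : cp' (0 : ℍ[F, -1, -3]) = 0 := by simp [cp']
        have e3 : cq (0 : ℍ[F, -1, -3]) = 0 := by simp [cq]
        have e4 : cq' (0 : ℍ[F, -1, -3]) = 0 := by simp [cq']
        fin_cases i
        exacts [e1, e2, e3, e4]
      map_add' := by
        intro x y
        ext i
        have e1 : cp (x.1 + y.1) = cp x.1 + cp y.1 := by simp [cp]; ring
        have e2 : cp' (x.1 + y.1) = cp' x.1 + cp' y.1 := by simp [cp']; ring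
        have e3 : cq (x.1 + y.1) = cq x.1 + cq y.1 := by simp [cq]; ring
        have e4 : cq' (x.1 + y.1) = cq' x.1 + cq' y.1 := by simp [cq']; ring
        fin_cases i
        exacts [e1, e2, e3, e4] }

theorem latt_fg (h : Good P) : (latt h).toAddSubgroup.FG := by
  have hN : IsNoetherian ℤ (Fin 4 → 𝓞 F) := inferInstance
  have hinj : Function.Injective (coordsMap h) := by
    intro x y hxy
    apply Subtype.ext
    have e : ∀ i, ((coordsMap h x i : 𝓞 F) : F) = (coordsMap h y i : 𝓞 F) := by
      intro i; rw [hxy]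
    exact ext_coords (e 0) (e 2) (e 1) (e 3)
  have : Module.Finite ℤ (latt h).toAddSubgroup := Module.Finite.of_injective _ hinj
  have h2 : AddGroup.FG (latt h).toAddSubgroup := Module.Finite.iff_addGroup_fg.1 this
  exact (AddGroup.fg_iff_addSubgroup_fg _).1 h2

theorem isOrder_of_coords {O : Subring ℍ[F, -1, -3]} (h1 : scalarSet F _ ⊆ (O : Set ℍ[F, -1, -3]))
    (h2 : O.toAddSubgroup.FG) (hi : iQ ∈ O) (hw : wQ ∈ O) : IsOrder F O := by
  refine ⟨h1, h2, ?_⟩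
  rw [eq_top_iff]
  rintro x -
  have : x = (x.re + x.imJ) • (1 : ℍ[F, -1, -3]) + (x.imI + x.imK) • iQ + (2 * x.imJ) • wQ
      + (2 * x.imK) • (iQ * wQ) := by
    ext <;> simp [iQ, wQ] <;> ring
  rw [this]
  have hs : ∀ (c : F) {y : ℍ[F, -1, -3]}, y ∈ O → c • y ∈ Submodule.span F (O : Set ℍ[F, -1, -3]) :=
    fun c y hy => Submodule.smul_mem _ c (Submodule.subset_span hy)
  exact Submodule.add_mem _ (Submodule.add_mem _ (Submodule.add_mem _ (hs _ O.one_mem) (hs _ hi))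
    (hs _ hw)) (hs _ (O.mul_mem hi hw))

theorem latt_isOrder (h : Good P) : IsOrder F (latt h) := by
  refine isOrder_of_coords ?_ (latt_fg h) (iQ_mem_latt h) (wQ_mem_latt h)
  rintro _ ⟨r, rfl⟩
  have hr : IsIntegral ℤ (algebraMap (𝓞 F) F r) := r.2
  change algebraMap F ℍ[F, -1, -3] (algebraMap (𝓞 F) F r) ∈ latt h
  generalize algebraMap (𝓞 F) F r = c at hr ⊢
  rw [mem_latt]
  have e1 : cp (algebraMap F ℍ[F, -1, -3] c) = -2 * c := by
    simp [cp, QuaternionAlgebra.algebraMap_eq]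
  have e2 : cp' (algebraMap F ℍ[F, -1, -3] c) = 0 := by simp [cp', QuaternionAlgebra.algebraMap_eq]
  have e3 : cq (algebraMap F ℍ[F, -1, -3] c) = 3 * -c := by
    simp [cq, QuaternionAlgebra.algebraMap_eq]
  have e4 : cq' (algebraMap F ℍ[F, -1, -3] c) = 3 * 0 := by
    simp [cq', QuaternionAlgebra.algebraMap_eq]
  rw [e1, e2, e3, e4]
  exact ⟨(isIntegral_ofNat 2).neg.mul hr, isIntegral_zero, h.three hr.neg isIntegral_zero⟩

/-- Integrality of the coordinates of the elements of an order containing `i` and `w`. -/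
theorem IsOrder.coords_integral {O : Subring ℍ[F, -1, -3]} (hO : IsOrder F O) (hi : iQ ∈ O)
    (hw : wQ ∈ O) {x : ℍ[F, -1, -3]} (hx : x ∈ O) : IsIntegral ℤ (cp x) ∧ IsIntegral ℤ (cp' x) ∧
      IsIntegral ℤ (cq x) ∧ IsIntegral ℤ (cq' x) := by
  have t1 := hO.trace_integral hx
  have t2 := hO.trace_integral (O.mul_mem hx hi)
  have t3 := hO.trace_integral (O.mul_mem hx hw)
  have t4 := hO.trace_integral (O.mul_mem (O.mul_mem hx hw) hi)
  refine ⟨?_, ?_, ?_, ?_⟩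
  · have e : cp x = -(2 * x.re) := by simp [cp]
    rw [e]; exact t1.neg
  · have e : cp' x = 2 * (x * iQ).re := by simp [cp', iQ]
    rw [e]; exact t2
  · have e : cq x = 2 * (x * wQ).re - 2 * x.re := by simp [cq, wQ]; ring
    rw [e]; exact t3.sub t1
  · have e : cq' x = 2 * (x * iQ).re - 2 * (x * wQ * iQ).re := by simp [cq', wQ, iQ]; ring
    rw [e]; exact t2.sub t4

theorem IsOrder.isotropy {O : Subring ℍ[F, -1, -3]} (hO : IsOrder F O) (hi : iQ ∈ O)
    (hw : wQ ∈ O) {x y : ℍ[F, -1, -3]} (hx : x ∈ O) (hy : y ∈ O) :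
    IsIntegral ℤ ((cq x * cq y + cq' x * cq' y) / 3) := by
  obtain ⟨p1, p2, q1, q2⟩ := hO.coords_integral hi hw hx
  obtain ⟨p3, p4, q3, q4⟩ := hO.coords_integral hi hw hy
  have t := hO.coords_integral hi hw (O.mul_mem hx hy)
  have i2 := isIntegral_ofNat (F := F) 2
  have e : (cq x * cq y + cq' x * cq' y) / 3 = 2 * (cp (x * y) - (cp x * cp y
      - (cp x * cq y + cq x * cp y) + 2 * (cp' x * cp' y) - (cp' x * cq' y + cq' x * cp' y)))
      - (cq x * cq y + cq' x * cq' y) := by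
    rw [cp_mul]; ring
  rw [e]
  exact (i2.mul (t.1.sub ((((p1.mul p3).sub ((p1.mul q3).add (q1.mul p3))).add
    (i2.mul (p2.mul p4))).sub ((p2.mul q4).add (q2.mul p4))))).sub ((q1.mul q3).add (q2.mul q4))

end Lattice

section LatticeCases

/-- Conjugation by `j`. -/
def jconj (x : ℍ[F, -1, -3]) : ℍ[F, -1, -3] := ⟨x.re, -x.imI, x.imJ, -x.imK⟩

theorem jconj_jconj (x : ℍ[F, -1, -3]) : jconj (jconj x) = x := by
  ext <;> simp [jconj]

theorem Good.jconj {P : F → F → Prop} (h : Good P) : Good fun a b => P a (-b) where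
  int hab := ⟨(h.int hab).1, by simpa using (h.int hab).2.neg⟩
  add hab hab' := by simpa [add_comm] using h.add hab hab'
  smul hc hab := by simpa using h.smul hc hab
  rot hab := by simpa using h.neg (h.rot hab)
  iso hab hab' := by simpa using h.iso hab hab'
  three ha hb := by simpa using h.three ha hb.neg

theorem mem_latt_jconj {P : F → F → Prop} (h : Good P) {x : ℍ[F, -1, -3]} :
    x ∈ latt h.jconj ↔ jconj x ∈ latt h := by
  have e1 : cp (jconj x) = cp x := rfl
  have e2 : cp' (jconj x) = - cp' x := by simp [cp', jconj]
  have e3 : cq (jconj x) = cq x := rfl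
  have e4 : cq' (jconj x) = - cq' x := by simp [cq', jconj]; ring
  rw [mem_latt, mem_latt, e1, e2, e3, e4, IsIntegral.neg_iff]

theorem good_split : Good fun a b : F => IsIntegral ℤ (a / 3) ∧ IsIntegral ℤ (b / 3) where
  int {a b} h := by
    have i3 := isIntegral_ofNat (F := F) 3
    have ea : a = 3 * (a / 3) := by field_simp
    have eb : b = 3 * (b / 3) := by field_simp
    rw [ea, eb]
    exact ⟨i3.mul h.1, i3.mul h.2⟩
  add h h' := by
    rw [add_div, add_div]; exact ⟨h.1.add h'.1, h.2.add h'.2⟩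
  smul hc h := by
    rw [mul_div_assoc, mul_div_assoc]; exact ⟨hc.mul h.1, hc.mul h.2⟩
  rot h := by rw [neg_div]; exact ⟨h.2, h.1.neg⟩
  iso {a b a' b'} h h' := by
    have e : (a * a' + b * b') / 3 = 3 * (a / 3 * (a' / 3) + b / 3 * (b' / 3)) := by
      field_simp
    rw [e]
    exact (isIntegral_ofNat 3).mul ((h.1.mul h'.1).add (h.2.mul h'.2))
  three {a b} ha hb := by
    rw [mul_div_cancel_left₀ a three_ne_zero, mul_div_cancel_left₀ b three_ne_zero]
    exact ⟨ha, hb⟩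

variable {d : ℕ} {s : F} {σ : F →+* ℝ}

theorem IsRealQuad.good_ramified (h : IsRealQuad d s σ) (hd : 3 ∣ d) :
    Good fun a b : F => (IsIntegral ℤ a ∧ IsIntegral ℤ (a * s / 3)) ∧
      (IsIntegral ℤ b ∧ IsIntegral ℤ (b * s / 3)) := by
  have hs := h.isIntegral_gen
  have key : ∀ {a a' : F}, IsIntegral ℤ a ∧ IsIntegral ℤ (a * s / 3) →
      IsIntegral ℤ a' ∧ IsIntegral ℤ (a' * s / 3) → IsIntegral ℤ (a * a' / 3) := by
    intro a a' ha ha'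
    obtain ⟨e, rfl⟩ := hd
    have hcop : IsCoprime (e : ℤ) 3 := by
      rw [Int.isCoprime_iff_gcd_eq_one]
      have : Nat.Coprime 3 e := Nat.coprime_of_squarefree_mul h.sqf
      exact_mod_cast this.symm
    obtain ⟨u, v, huv⟩ := hcop
    have hF : (u : F) * e + v * 3 = 1 := by exact_mod_cast huv
    have hsq : s ^ 2 = 3 * e := by rw [h.sq]; push_cast; ring
    have e1 : a * a' / 3 = u * (a * s / 3 * (a' * s / 3)) + v * (a * a') := by
      have : a * s / 3 * (a' * s / 3) = a * a' * s ^ 2 / 9 := by ring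
      rw [this, hsq]
      linear_combination (-(a * a') / 3) * hF
    rw [e1]
    exact ((isIntegral_intCast u).mul (ha.2.mul ha'.2)).add
      ((isIntegral_intCast v).mul (ha.1.mul ha'.1))
  refine ⟨fun hab => ⟨hab.1.1, hab.2.1⟩, ?_, ?_, ?_, ?_, ?_⟩
  · intro a b a' b' h1 h2
    rw [add_mul, add_mul, add_div, add_div]
    exact ⟨⟨h1.1.1.add h2.1.1, h1.1.2.add h2.1.2⟩, h1.2.1.add h2.2.1, h1.2.2.add h2.2.2⟩
  · intro c a b hc h1
    have ea : c * a * s / 3 = c * (a * s / 3) := by ring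
    have eb : c * b * s / 3 = c * (b * s / 3) := by ring
    rw [ea, eb]
    exact ⟨⟨hc.mul h1.1.1, hc.mul h1.1.2⟩, hc.mul h1.2.1, hc.mul h1.2.2⟩
  · intro a b h1
    rw [neg_mul, neg_div]
    exact ⟨h1.2, h1.1.1.neg, h1.1.2.neg⟩
  · intro a b a' b' h1 h2
    rw [add_div]
    exact (key h1.1 h2.1).add (key h1.2 h2.2)
  · intro a b ha hb
    have i3 := isIntegral_ofNat (F := F) 3
    have ea : 3 * a * s / 3 = a * s := by ring
    have eb : 3 * b * s / 3 = b * s := by ring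
    rw [ea, eb]
    exact ⟨⟨i3.mul ha, ha.mul hs⟩, i3.mul hb, hb.mul hs⟩

theorem IsRealQuad.good_inert (h : IsRealQuad d s σ) (hd : d % 3 = 2) :
    Good fun a b : F => IsIntegral ℤ a ∧ IsIntegral ℤ b ∧ IsIntegral ℤ ((a - s * b) / 3) := by
  have hs := h.isIntegral_gen
  obtain ⟨e, he⟩ : ∃ e : ℕ, d + 1 = 3 * e := ⟨(d + 1) / 3, by omega⟩
  have hsq : s ^ 2 = 3 * e - 1 := by
    rw [h.sq, eq_sub_iff_add_eq]; exact_mod_cast he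
  have ie : IsIntegral ℤ (e : F) := by exact_mod_cast isIntegral_intCast (F := F) e
  refine ⟨fun hab => ⟨hab.1, hab.2.1⟩, ?_, ?_, ?_, ?_, ?_⟩
  · intro a b a' b' h1 h2
    have e : (a + a' - s * (b + b')) / 3 = (a - s * b) / 3 + (a' - s * b') / 3 := by ring
    rw [e]
    exact ⟨h1.1.add h2.1, h1.2.1.add h2.2.1, h1.2.2.add h2.2.2⟩
  · intro c a b hc h1
    have e : (c * a - s * (c * b)) / 3 = c * ((a - s * b) / 3) := by ring
    rw [e]
    exact ⟨hc.mul h1.1, hc.mul h1.2.1, hc.mul h1.2.2⟩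
  · intro a b h1
    have e' : (b - s * -a) / 3 = s * ((a - s * b) / 3) + e * b := by
      linear_combination (b / 3) * hsq
    rw [e']
    exact ⟨h1.2.1, h1.1.neg, (hs.mul h1.2.2).add (ie.mul h1.2.1)⟩
  · intro a b a' b' h1 h2
    have e' : (a * a' + b * b') / 3 = e * (b * b') + s * b * ((a' - s * b') / 3) +
        s * b' * ((a - s * b) / 3) + 3 * ((a - s * b) / 3 * ((a' - s * b') / 3)) := by
      linear_combination (b * b' / 3) * hsq
    rw [e']
    exact (((ie.mul (h1.2.1.mul h2.2.1)).add ((hs.mul h1.2.1).mul h2.2.2)).add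
      ((hs.mul h2.2.1).mul h1.2.2)).add ((isIntegral_ofNat 3).mul (h1.2.2.mul h2.2.2))
  · intro a b ha hb
    have i3 := isIntegral_ofNat (F := F) 3
    have e : (3 * a - s * (3 * b)) / 3 = a - s * b := by ring
    rw [e]
    exact ⟨i3.mul ha, i3.mul hb, ha.sub (hs.mul hb)⟩

/-- The isotropy relation between residues modulo `3`. -/
theorem IsRealQuad.residue_isotropy (h : IsRealQuad d s σ) {m n m' n' M N M' N' : ℤ}
    {y y' z z' : F} (hy : IsIntegral ℤ y) (hy' : IsIntegral ℤ y') (hz : IsIntegral ℤ z)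
    (hz' : IsIntegral ℤ z')
    (hX : IsIntegral ℤ (((m + n * s + 3 * y) * (M + N * s + 3 * z) +
      (m' + n' * s + 3 * y') * (M' + N' * s + 3 * z')) / 3)) :
    (m * M + d * (n * N) + m' * M' + d * (n' * N') : ZMod 3) = 0 ∧
      (m * N + n * M + m' * N' + n' * M' : ZMod 3) = 0 := by
  have hs := h.isIntegral_gen
  have i3 := isIntegral_ofNat (F := F) 3
  have hi : ∀ k : ℤ, IsIntegral ℤ (k : F) := isIntegral_intCast
  have hr : ∀ (k l : ℤ), IsIntegral ℤ (k + l * s) := fun k l => (hi k).add ((hi l).mul hs)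
  have e : (((m * M + d * (n * N) + m' * M' + d * (n' * N') : ℤ) : F) +
      ((m * N + n * M + m' * N' + n' * M' : ℤ) : F) * s) / 3 =
      ((m + n * s + 3 * y) * (M + N * s + 3 * z) +
      (m' + n' * s + 3 * y') * (M' + N' * s + 3 * z')) / 3 -
      (((m + n * s) * z + y * (M + N * s) + 3 * (y * z)) +
      ((m' + n' * s) * z' + y' * (M' + N' * s) + 3 * (y' * z'))) := by
    push_cast
    linear_combination (-(n * N + n' * N' : F) / 3) * h.sq
  have hI : IsIntegral ℤ ((((m * M + d * (n * N) + m' * M' + d * (n' * N') : ℤ) : F) +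
      ((m * N + n * M + m' * N' + n' * M' : ℤ) : F) * s) / 3) := by
    rw [e]
    exact hX.sub (((((hr m n).mul hz).add (hy.mul (hr M N))).add (i3.mul (hy.mul hz))).add
      ((((hr m' n').mul hz').add (hy'.mul (hr M' N'))).add (i3.mul (hy'.mul hz'))))
  obtain ⟨h1, h2⟩ := h.three_dvd_of_isIntegral hI
  constructor
  · have := (ZMod.intCast_zmod_eq_zero_iff_dvd _ 3).2 h1
    exact_mod_cast this
  · have := (ZMod.intCast_zmod_eq_zero_iff_dvd _ 3).2 h2
    exact_mod_cast this

theorem IsRealQuad.isIntegral_of_residue (h : IsRealQuad d s σ) {m n : ℤ} {y : F}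
    (hy : IsIntegral ℤ y) (hm : (m : ZMod 3) = 0) (hn : (n : ZMod 3) = 0) :
    IsIntegral ℤ ((m + n * s + 3 * y) / 3) := by
  obtain ⟨a, rfl⟩ := (ZMod.intCast_zmod_eq_zero_iff_dvd _ 3).1 hm
  obtain ⟨b, rfl⟩ := (ZMod.intCast_zmod_eq_zero_iff_dvd _ 3).1 hn
  have e : ((((3 : ℕ) * a : ℤ) : F) + (((3 : ℕ) * b : ℤ) : F) * s + 3 * y) / 3 = a + b * s + y := by
    push_cast; ring
  rw [e]
  exact ((isIntegral_intCast a).add ((isIntegral_intCast b).mul h.isIntegral_gen)).add hy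

variable {O : Subring ℍ[F, -1, -3]}

theorem IsRealQuad.le_latt_split (h : IsRealQuad d s σ) (hd : d % 3 = 1) (hO : IsOrder F O)
    (hi : iQ ∈ O) (hw : wQ ∈ O) : O ≤ latt good_split := by
  intro x hx
  obtain ⟨h1, h2, h3, h4⟩ := hO.coords_integral hi hw hx
  have hX := hO.isotropy hi hw hx hx
  refine ⟨h1, h2, ?_⟩
  obtain ⟨m, n, y, hy, e⟩ := h.exists_residue h3
  obtain ⟨m', n', y', hy', e'⟩ := h.exists_residue h4
  rw [e, e'] at hX ⊢
  obtain ⟨r1, r2⟩ := h.residue_isotropy hy hy' hy hy' hX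
  have hd3 : (d : ZMod 3) = 1 := by
    rw [← ZMod.natCast_mod, hd]; rfl
  rw [hd3] at r1
  have key : ∀ m n m' n' : ZMod 3, m * m + 1 * (n * n) + m' * m' + 1 * (n' * n') = 0 →
      m * n + n * m + m' * n' + n' * m' = 0 → m = 0 ∧ n = 0 ∧ m' = 0 ∧ n' = 0 := by decide
  obtain ⟨k1, k2, k3, k4⟩ := key _ _ _ _ r1 r2
  exact ⟨h.isIntegral_of_residue hy k1 k2, h.isIntegral_of_residue hy' k3 k4⟩

theorem IsRealQuad.le_latt_ramified (h : IsRealQuad d s σ) (hd : 3 ∣ d) (hO : IsOrder F O)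
    (hi : iQ ∈ O) (hw : wQ ∈ O) : O ≤ latt (h.good_ramified hd) := by
  intro x hx
  obtain ⟨h1, h2, h3, h4⟩ := hO.coords_integral hi hw hx
  have hX := hO.isotropy hi hw hx hx
  suffices IsIntegral ℤ (cq x * s / 3) ∧ IsIntegral ℤ (cq' x * s / 3) from
    ⟨h1, h2, ⟨h3, this.1⟩, h4, this.2⟩
  obtain ⟨m, n, y, hy, e⟩ := h.exists_residue h3
  obtain ⟨m', n', y', hy', e'⟩ := h.exists_residue h4
  rw [e, e'] at hX ⊢
  obtain ⟨r1, -⟩ := h.residue_isotropy hy hy' hy hy' hX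
  have hd3 : (d : ZMod 3) = 0 := (ZMod.natCast_eq_zero_iff d 3).2 hd
  rw [hd3] at r1
  have key : ∀ m n m' n' : ZMod 3, m * m + 0 * (n * n) + m' * m' + 0 * (n' * n') = 0 →
      m = 0 ∧ m' = 0 := by decide
  obtain ⟨k1, k2⟩ := key _ _ _ _ r1
  obtain ⟨a, rfl⟩ := hd
  have aux : ∀ {m n : ℤ} {y : F}, IsIntegral ℤ y → (m : ZMod 3) = 0 →
      IsIntegral ℤ ((m + n * s + 3 * y) * s / 3) := by
    intro m n y hy hm
    have e : (m + n * s + 3 * y) * s / 3 = (m + (0 : ℤ) * s + 3 * y) / 3 * s + (n * a : ℤ) := by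
      have := h.sq
      push_cast at this ⊢
      linear_combination (n / 3 : F) * this
    rw [e]
    exact ((h.isIntegral_of_residue hy hm (by simp)).mul h.isIntegral_gen).add
      (isIntegral_intCast _)
  exact ⟨aux hy k1, aux hy' k2⟩

theorem IsRealQuad.le_latt_inert (h : IsRealQuad d s σ) (hd : d % 3 = 2) (hO : IsOrder F O)
    (hi : iQ ∈ O) (hw : wQ ∈ O) :
    O ≤ latt (h.good_inert hd) ∨ O ≤ latt (h.good_inert hd).jconj := by
  by_contra! hc
  obtain ⟨x, hx, hx'⟩ := SetLike.not_le_iff_exists.1 hc.1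
  obtain ⟨z, hz, hz'⟩ := SetLike.not_le_iff_exists.1 hc.2
  obtain ⟨h1, h2, h3, h4⟩ := hO.coords_integral hi hw hx
  obtain ⟨l1, l2, l3, l4⟩ := hO.coords_integral hi hw hz
  have hX := hO.isotropy hi hw hx hx
  have hZ := hO.isotropy hi hw hz hz
  have hXZ := hO.isotropy hi hw hx hz
  have g1 : ¬ IsIntegral ℤ ((cq x - s * cq' x) / 3) := fun g => hx' ⟨h1, h2, h3, h4, g⟩
  have g2 : ¬ IsIntegral ℤ ((cq z - s * -cq' z) / 3) := fun g => hz' ⟨l1, l2, l3, l4.neg, g⟩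
  obtain ⟨m, n, y, hy, e⟩ := h.exists_residue h3
  obtain ⟨m', n', y', hy', e'⟩ := h.exists_residue h4
  obtain ⟨M, N, t, ht, f⟩ := h.exists_residue l3
  obtain ⟨M', N', t', ht', f'⟩ := h.exists_residue l4
  rw [e, e'] at hX hXZ g1
  rw [f, f'] at hZ hXZ g2
  obtain ⟨r1, r2⟩ := h.residue_isotropy hy hy' hy hy' hX
  obtain ⟨s1, s2⟩ := h.residue_isotropy ht ht' ht ht' hZ
  obtain ⟨u1, u2⟩ := h.residue_isotropy hy hy' ht ht' hXZ
  have hd3 : (d : ZMod 3) = -1 := by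
    rw [← ZMod.natCast_mod, hd]; rfl
  rw [hd3] at r1 s1 u1
  have hs := h.isIntegral_gen
  have c1 : ¬ ((m : ZMod 3) = -n' ∧ (n : ZMod 3) = m') := by
    rintro ⟨a, b⟩
    apply g1
    have e : (m + n * s + 3 * y - s * (m' + n' * s + 3 * y')) / 3 =
        (((m - d * n' : ℤ) : F) + ((n - m' : ℤ) : F) * s + 3 * (y - s * y')) / 3 := by
      push_cast; linear_combination (-n' / 3 : F) * h.sq
    rw [e]
    refine h.isIntegral_of_residue (hy.sub (hs.mul hy')) ?_ ?_
    · push_cast; rw [hd3, a]; ring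
    · push_cast; rw [b]; ring
  have c2 : ¬ ((M : ZMod 3) = N' ∧ (N : ZMod 3) = -M') := by
    rintro ⟨a, b⟩
    apply g2
    have e : (M + N * s + 3 * t - s * -(M' + N' * s + 3 * t')) / 3 =
        (((M + d * N' : ℤ) : F) + ((N + M' : ℤ) : F) * s + 3 * (t + s * t')) / 3 := by
      push_cast; linear_combination (N' / 3 : F) * h.sq
    rw [e]
    refine h.isIntegral_of_residue (ht.add (hs.mul ht')) ?_ ?_
    · push_cast; rw [hd3, a]; ring
    · push_cast; rw [b]; ring
  have key : ∀ m n m' n' : ZMod 3, m * m + -1 * (n * n) + m' * m' + -1 * (n' * n') = 0 →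
      m * n + n * m + m' * n' + n' * m' = 0 → (m = -n' ∧ n = m') ∨ (m = n' ∧ n = -m') := by decide
  obtain ⟨v1, v2⟩ := (key _ _ _ _ r1 r2).resolve_left c1
  obtain ⟨v3, v4⟩ := (key _ _ _ _ s1 s2).resolve_right c2
  rw [v1, v2, v3, v4] at u1 u2
  rw [v1, v2] at c1
  rw [v3, v4] at c2
  have key2 : ∀ m' n' M' N' : ZMod 3,
      n' * -N' + -1 * (-m' * M') + m' * M' + -1 * (n' * N') = 0 →
      n' * M' + -m' * -N' + m' * N' + n' * M' = 0 →
      (n' = -n' ∧ -m' = m') ∨ (-N' = N' ∧ M' = -M') := by decide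
  exact (key2 _ _ _ _ u1 u2).elim c1 c2

/-- There is an order of `(-1,-3)` containing, up to conjugation by `j`, every order that
contains `i` and `w`. -/
theorem IsRealQuad.exists_latt (h : IsRealQuad d s σ) : ∃ P : F → F → Prop, ∃ hP : Good P,
    ∀ O : Subring ℍ[F, -1, -3], IsOrder F O → iQ ∈ O → wQ ∈ O →
      O ≤ latt hP ∨ O ≤ latt hP.jconj := by
  have : d % 3 = 0 ∨ d % 3 = 1 ∨ d % 3 = 2 := by omega
  rcases this with hd | hd | hd
  · have hd := Nat.dvd_of_mod_eq_zero hd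
    exact ⟨_, h.good_ramified hd, fun O hO hi hw => .inl (h.le_latt_ramified hd hO hi hw)⟩
  · exact ⟨_, good_split, fun O hO hi hw => .inl (h.le_latt_split hd hO hi hw)⟩
  · exact ⟨_, h.good_inert hd, fun O hO hi hw => h.le_latt_inert hd hO hi hw⟩

/-- A maximal order of `(-1,-3)` unique up to conjugation by `j` among those containing `i`
and `w`. -/
theorem IsRealQuad.exists_maximal (h : IsRealQuad d s σ) : ∃ L : Subring ℍ[F, -1, -3],
    IsMaximalOrder F L ∧ iQ ∈ L ∧ wQ ∈ L ∧
    ∀ O : Subring ℍ[F, -1, -3], IsMaximalOrder F O → iQ ∈ O → wQ ∈ O →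
      (∀ x, x ∈ O ↔ x ∈ L) ∨ (∀ x, x ∈ O ↔ jconj x ∈ L) := by
  obtain ⟨P, hP, hle⟩ := h.exists_latt
  refine ⟨latt hP, ⟨latt_isOrder hP, fun O hO hLO => ?_⟩, iQ_mem_latt hP, wQ_mem_latt hP,
    fun O hO hi hw => ?_⟩
  · rcases hle O hO (hLO (iQ_mem_latt hP)) (hLO (wQ_mem_latt hP)) with h1 | h1
    · exact le_antisymm h1 hLO
    · refine le_antisymm (fun x hx => ?_) hLO
      have h2 := (mem_latt_jconj hP).1 (h1 hx)
      have h3 := (mem_latt_jconj hP).1 (h1 (hLO h2))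
      rwa [jconj_jconj] at h3
  · rcases hle O hO.1 hi hw with h1 | h1
    · left
      rw [← hO.2 _ (latt_isOrder hP) h1]; exact fun x => Iff.rfl
    · right
      rw [← hO.2 _ (latt_isOrder hP.jconj) h1]; exact fun x => mem_latt_jconj hP

end LatticeCases

section Units

theorem re_mul_comm {A B : F} (x y : ℍ[F, A, B]) : (x * y).re = (y * x).re := by
  simp; ring

theorem redNorm_iQ : redNorm F (iQ : ℍ[F, -1, -3]) = 1 := by
  simp [redNorm_eq, iQ]

theorem redNorm_wQ : redNorm F (wQ : ℍ[F, -1, -3]) = 1 := by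
  simp [redNorm_eq, wQ]; ring

variable {d : ℕ} {s : F} {σ : F →+* ℝ} {O : Subring ℍ[F, -1, -3]}

theorem IsRealQuad.trace_of_norm_one (h : IsRealQuad d s σ) (hO : IsOrder F O)
    {x : ℍ[F, -1, -3]} (hx : x ∈ O) (hn : redNorm F x = 1) :
    ∃ n : ℤ, 2 * x.re = n ∧ -2 ≤ n ∧ n ≤ 2 := by
  refine h.exists_int_of_sq_le_four (hO.trace_integral hx) fun ρ => ?_
  have := sq_re_le_redNorm (σ := ρ) (A := -1) (B := -3) (by simp)
    (by rw [map_neg, map_ofNat]; norm_num) x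
  rw [hn, map_one] at this
  rw [map_mul, map_ofNat]
  linarith

theorem eisenstein_form_eq_three {a b c e : ℤ} (ha : -2 ≤ a ∧ a ≤ 2) (hb : -2 ≤ b ∧ b ≤ 2)
    (hc : -2 ≤ c ∧ c ≤ 2) (he : -2 ≤ e ∧ e ≤ 2)
    (h : a ^ 2 + a * b + b ^ 2 + (c ^ 2 + c * e + e ^ 2) = 3) :
    (c = 0 ∧ e = 0 ∧ a ≠ 0 ∧ (a = -1 → b = -1 ∨ b = 2)) ∨
    (a = 0 ∧ b = 0 ∧ ((c = 1 ∧ e = 1) ∨ (c = -1 ∧ e = -1) ∨ (c = 2 ∧ e = -1) ∨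
      (c = -2 ∧ e = 1) ∨ (c = 1 ∧ e = -2) ∨ (c = -1 ∧ e = 2))) := by
  obtain ⟨ha, ha'⟩ := ha
  obtain ⟨hb, hb'⟩ := hb
  obtain ⟨hc, hc'⟩ := hc
  obtain ⟨he, he'⟩ := he
  interval_cases a <;> interval_cases b <;> interval_cases c <;> interval_cases e <;>
    simp at h ⊢

theorem IsRealQuad.norm_one_cases (h : IsRealQuad d s σ) (hO : IsOrder F O) (hi : iQ ∈ O)
    (hw : wQ ∈ O) {x : ℍ[F, -1, -3]} (hx : x ∈ O) (hn : redNorm F x = 1) :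
    (x.re ≠ 0 ∧ x.imI = 0 ∧ x.imK = 0 ∧ (2 * x.re = -1 → 2 * x.imJ = 1 ∨ 2 * x.imJ = -1)) ∨
    (x.re = 0 ∧ x.imJ = 0 ∧ ((x.imI = 1 ∧ x.imK = 0) ∨ (x.imI = -1 ∧ x.imK = 0) ∨
      (2 * x.imI = 1 ∧ 2 * x.imK = 1) ∨ (2 * x.imI = 1 ∧ 2 * x.imK = -1) ∨
      (2 * x.imI = -1 ∧ 2 * x.imK = 1) ∨ (2 * x.imI = -1 ∧ 2 * x.imK = -1))) := by
  obtain ⟨a, ea, ha⟩ := h.trace_of_norm_one hO hx hn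
  obtain ⟨b, eb, hb⟩ := h.trace_of_norm_one hO (O.mul_mem hx hw)
    (by rw [redNorm_mul, hn, redNorm_wQ, one_mul])
  obtain ⟨c, ec, hc⟩ := h.trace_of_norm_one hO (O.mul_mem hx hi)
    (by rw [redNorm_mul, hn, redNorm_iQ, one_mul])
  obtain ⟨e, ee, he⟩ := h.trace_of_norm_one hO (O.mul_mem (O.mul_mem hx hw) hi)
    (by rw [redNorm_mul, redNorm_mul, hn, redNorm_wQ, redNorm_iQ, one_mul, one_mul])
  have fa : x.re = a / 2 := by rw [← ea]; ring
  have fc : x.imI = -c / 2 := by rw [← ec]; simp [iQ]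
  have fb : x.imJ = -(2 * b + a) / 6 := by rw [← ea, ← eb]; simp [wQ]; ring
  have fe : x.imK = (2 * e + c) / 6 := by rw [← ec, ← ee]; simp [iQ, wQ]; ring
  have hq : a ^ 2 + a * b + b ^ 2 + (c ^ 2 + c * e + e ^ 2) = 3 := by
    rw [redNorm_eq, fa, fb, fc, fe] at hn
    have : ((a ^ 2 + a * b + b ^ 2 + (c ^ 2 + c * e + e ^ 2) : ℤ) : F) = (3 : ℤ) := by
      push_cast; linear_combination 3 * hn
    exact_mod_cast this
  rw [fa, fb, fc, fe]
  rcases eisenstein_form_eq_three ha hb hc he hq with ⟨rfl, rfl, h1, h2⟩ | ⟨rfl, rfl, h1⟩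
  · left
    refine ⟨by simpa using h1, by simp, by simp, fun h3 => ?_⟩
    have h4 : (a : F) = (-1 : ℤ) := by push_cast; linear_combination h3
    have h5 : a = -1 := by exact_mod_cast h4
    rcases h2 h5 with rfl | rfl <;> rw [h4]
    · left; push_cast; ring
    · right; push_cast; ring
  · right
    refine ⟨by simp, by simp, ?_⟩
    rcases h1 with ⟨rfl, rfl⟩ | ⟨rfl, rfl⟩ | ⟨rfl, rfl⟩ | ⟨rfl, rfl⟩ | ⟨rfl, rfl⟩ | ⟨rfl, rfl⟩
    · right; right; right; right; left; constructor <;> push_cast <;> ring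
    · right; right; right; left; constructor <;> push_cast <;> ring
    · right; left; constructor <;> push_cast <;> ring
    · left; constructor <;> push_cast <;> ring
    · right; right; right; right; right; constructor <;> push_cast <;> ring
    · right; right; left; constructor <;> push_cast <;> ring

/-- Units commuting with `w` are scalar multiples of powers of `w`. -/
theorem IsRealQuad.unit_commuting (h : IsRealQuad d s σ) (hO : IsOrder F O) (hi : iQ ∈ O)
    (hw : wQ ∈ O)
    (H3 : ∀ f : F, f ≠ 0 → IsIntegral ℤ (3 * f ^ 2) → IsIntegral ℤ (3 * f ^ 2)⁻¹ → False)
    {u v : ℍ[F, -1, -3]} (hu : u ∈ O) (hv : v ∈ O) (huv : u * v = 1) (hvu : v * u = 1)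
    (hc : u * wQ = wQ * u) : ∃ c : F, ∃ k : ℕ, u = algebraMap F _ c * wQ ^ k := by
  have hnuv : redNorm F u * redNorm F v = 1 := by rw [← redNorm_mul, huv, redNorm_one]
  have hI : u.imI = 0 := by
    have := congrArg QuaternionAlgebra.imK hc
    simp [wQ] at this
    linear_combination this
  have hK : u.imK = 0 := by
    have := congrArg QuaternionAlgebra.imI hc
    simp [wQ] at this
    linear_combination (-1 / 3 : F) * this
  have hnu : redNorm F u = u.re ^ 2 + 3 * u.imJ ^ 2 := by
    rw [redNorm_eq, hI, hK]; ring
  have hbad : ∀ f : F, redNorm F u = 3 * f ^ 2 → False := by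
    intro f hf
    have hf0 : f ≠ 0 := by
      rintro rfl
      rw [hf] at hnuv
      simp at hnuv
    refine H3 f hf0 (hf ▸ hO.redNorm_integral hu) ?_
    rw [← hf, ← eq_inv_of_mul_eq_one_right hnuv]
    exact hO.redNorm_integral hv
  have hz : redNorm F (u * iQ * v) = 1 := by
    rw [redNorm_mul, redNorm_mul, redNorm_iQ, mul_one, hnuv]
  have hzre : (u * iQ * v).re = 0 := by
    rw [re_mul_comm, ← mul_assoc, hvu, one_mul]; rfl
  have hzu : u * iQ = u * iQ * v * u := by rw [mul_assoc (u * iQ), hvu, mul_one]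
  rcases h.norm_one_cases hO hi hw (O.mul_mem (O.mul_mem hu hi) hv) hz with h1 | h1
  · exact absurd hzre h1.1
  generalize u * iQ * v = z at h1 hzu
  obtain ⟨z1, z2, h1⟩ := h1
  have e1 : u.re = z.imI * u.re - 3 * z.imK * u.imJ := by
    have := congrArg QuaternionAlgebra.imI hzu
    simp [iQ, z1, z2, hI, hK] at this
    linear_combination this
  have e2 : -u.imJ = z.imI * u.imJ + z.imK * u.re := by
    have := congrArg QuaternionAlgebra.imK hzu
    simp [iQ, z1, z2, hI, hK] at this
    linear_combination this
  rcases h1 with ⟨a, b⟩ | ⟨a, b⟩ | ⟨a, b⟩ | ⟨a, b⟩ | ⟨a, b⟩ | ⟨a, b⟩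
  · rw [a, b] at e2
    refine ⟨u.re, 0, ?_⟩
    ext <;> simp [QuaternionAlgebra.algebraMap_eq, hI, hK]
    linear_combination (-1 / 2 : F) * e2
  · rw [a, b] at e1
    refine (hbad u.imJ ?_).elim
    have : u.re = 0 := by linear_combination (1 / 2 : F) * e1
    rw [hnu, this]; ring
  · refine (hbad (2 * u.imJ) ?_).elim
    have : u.re = -3 * u.imJ := by
      linear_combination 2 * e1 + u.re * a - 3 * u.imJ * b
    rw [hnu, this]; ring
  · refine (hbad (2 * u.imJ) ?_).elim
    have : u.re = 3 * u.imJ := by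
      linear_combination 2 * e1 + u.re * a - 3 * u.imJ * b
    rw [hnu, this]; ring
  · have : u.re = -u.imJ := by
      linear_combination (2 / 3 : F) * e1 + (1 / 3 : F) * u.re * a - u.imJ * b
    refine ⟨2 * u.imJ, 1, ?_⟩
    ext <;> simp [QuaternionAlgebra.algebraMap_eq, hI, hK, wQ, this] <;> ring
  · have : u.re = u.imJ := by
      linear_combination (2 / 3 : F) * e1 + (1 / 3 : F) * u.re * a - u.imJ * b
    refine ⟨-2 * u.imJ, 2, ?_⟩
    ext <;> simp [QuaternionAlgebra.algebraMap_eq, hI, hK, wQ, this, pow_two] <;> ring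

theorem IsRealQuad.unit_cases (h : IsRealQuad d s σ) (hO : IsOrder F O) (hi : iQ ∈ O)
    (hw : wQ ∈ O)
    (H3 : ∀ f : F, f ≠ 0 → IsIntegral ℤ (3 * f ^ 2) → IsIntegral ℤ (3 * f ^ 2)⁻¹ → False)
    {u v : ℍ[F, -1, -3]} (hu : u ∈ O) (hv : v ∈ O) (huv : u * v = 1) (hvu : v * u = 1) :
    ∃ c : F, ∃ k : ℕ, u = algebraMap F _ c * wQ ^ k ∨ u = algebraMap F _ c * (iQ * wQ ^ k) := by
  have hnuv : redNorm F u * redNorm F v = 1 := by rw [← redNorm_mul, huv, redNorm_one]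
  have hz : redNorm F (u * wQ * v) = 1 := by
    rw [redNorm_mul, redNorm_mul, redNorm_wQ, mul_one, hnuv]
  have hzre : 2 * (u * wQ * v).re = -1 := by
    rw [re_mul_comm, ← mul_assoc, hvu, one_mul]; simp [wQ]; ring
  have hzu : u * wQ = u * wQ * v * u := by rw [mul_assoc (u * wQ), hvu, mul_one]
  rcases h.norm_one_cases hO hi hw (O.mul_mem (O.mul_mem hu hw) hv) hz with h1 | h1
  swap
  · rw [h1.1] at hzre; simp at hzre
  generalize u * wQ * v = z at h1 hzu hzre
  obtain ⟨-, z1, z2, h1⟩ := h1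
  have zre : z.re = -1 / 2 := by linear_combination (1 / 2 : F) * hzre
  rcases h1 hzre with h2 | h2
  · have : z = wQ := by
      ext
      · exact zre
      · exact z1
      · change z.imJ = 1 / 2; linear_combination (1 / 2 : F) * h2
      · exact z2
    rw [this] at hzu
    obtain ⟨c, k, hck⟩ := h.unit_commuting hO hi hw H3 hu hv huv hvu hzu
    exact ⟨c, k, .inl hck⟩
  · have hJ : z.imJ = -1 / 2 := by linear_combination (1 / 2 : F) * h2
    have : z = wQ * wQ := by
      ext <;> simp [wQ, zre, z1, z2, hJ] <;> ring
    rw [this] at hzu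
    have hiw : (iQ : ℍ[F, -1, -3]) * (wQ * wQ) = wQ * iQ := by
      ext <;> simp [iQ, wQ] <;> ring
    obtain ⟨c, k, hck⟩ := h.unit_commuting hO hi hw H3 (u := iQ * u) (v := v * -iQ)
      (O.mul_mem hi hu) (O.mul_mem hv (O.neg_mem hi))
      (by rw [mul_assoc, ← mul_assoc u, huv, one_mul, mul_neg, iQ_sq, neg_neg])
      (by rw [mul_assoc, ← mul_assoc (-iQ), neg_mul, iQ_sq, neg_neg, one_mul, hvu])
      (by rw [mul_assoc, hzu, ← mul_assoc, hiw, mul_assoc])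
    refine ⟨-c, k, .inr ?_⟩
    have h3 : iQ * (iQ * u) = iQ * (algebraMap F _ c * wQ ^ k) := by rw [hck]
    rw [← mul_assoc, iQ_sq, neg_one_mul, ← mul_assoc, ← Algebra.commutes, mul_assoc] at h3
    rw [map_neg, neg_mul, ← h3, neg_neg]

end Units

section Dihedral

variable {A B : F}

/-- A pair of quaternions satisfying the relations of `i` and `w = (-1+j)/2` in `(-1,-3)`. -/
structure IsPair (i w : ℍ[F, A, B]) : Prop where
  i_sq : i * i = -1
  w_sq : w * w + w + 1 = 0
  comm : i * w = w * w * i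

/-- The lift of `D₃` to the elements `w^k`, `i w^k`. -/
def elt (i w : ℍ[F, A, B]) : DihedralGroup 3 → ℍ[F, A, B]
  | .r k => w ^ k.val
  | .sr k => i * w ^ k.val

namespace IsPair

variable {i w : ℍ[F, A, B]}

theorem w_cube (h : IsPair i w) : w ^ 3 = 1 := by
  have : w ^ 3 - 1 = (w - 1) * (w * w + w + 1) := by noncomm_ring
  rw [h.w_sq, mul_zero] at this
  exact sub_eq_zero.1 this

theorem pow_val_add (h : IsPair i w) (a b : ZMod 3) : w ^ (a + b).val = w ^ a.val * w ^ b.val := by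
  rw [ZMod.val_add, ← pow_add, ← pow_eq_pow_mod _ h.w_cube]

theorem pow_val_mul_i (h : IsPair i w) (a : ZMod 3) : w ^ a.val * i = i * w ^ (-a).val := by
  have h1 : i * w ^ 2 = w * i := by
    calc i * w ^ 2 = i * w * w := by rw [pow_two, mul_assoc]
      _ = w * w * i * w := by rw [h.comm]
      _ = w * w * (i * w) := mul_assoc _ _ _
      _ = w * w * (w * w * i) := by rw [h.comm]
      _ = w ^ 3 * w * i := by noncomm_ring
      _ = w * i := by rw [h.w_cube, one_mul]
  have h2 : w ^ 2 * i = i * w := by rw [h.comm, pow_two]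
  fin_cases a
  · change w ^ 0 * i = i * w ^ 0
    simp
  · change w ^ 1 * i = i * w ^ 2
    rw [h1, pow_one]
  · change w ^ 2 * i = i * w ^ 1
    rw [h2, pow_one]

theorem elt_mul (h : IsPair i w) (g g' : DihedralGroup 3) :
    ∃ e : ℤ, e * e = 1 ∧ elt i w g * elt i w g' = algebraMap F _ (e : F) * elt i w (g * g') := by
  rcases g with a | a <;> rcases g' with b | b
  · exact ⟨1, rfl, by simp [elt, h.pow_val_add]⟩
  · refine ⟨1, rfl, ?_⟩
    simp only [elt, DihedralGroup.r_mul_sr]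
    rw [← mul_assoc, h.pow_val_mul_i, mul_assoc, ← h.pow_val_add, neg_add_eq_sub]
    simp
  · refine ⟨1, rfl, ?_⟩
    simp [elt, h.pow_val_add, mul_assoc]
  · refine ⟨-1, rfl, ?_⟩
    simp only [elt, DihedralGroup.sr_mul_sr]
    rw [mul_assoc, ← mul_assoc _ i, h.pow_val_mul_i, mul_assoc i, ← mul_assoc, h.i_sq,
      ← h.pow_val_add, neg_add_eq_sub]
    simp

theorem elt_one : elt i w 1 = 1 := by
  rw [DihedralGroup.one_def]; simp [elt]

theorem elt_mul_inv (h : IsPair i w) (g : DihedralGroup 3) :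
    ∃ e : ℤ, e * e = 1 ∧ elt i w g * elt i w g⁻¹ = algebraMap F _ (e : F) := by
  obtain ⟨e, he, h1⟩ := h.elt_mul g g⁻¹
  exact ⟨e, he, by rw [h1, mul_inv_cancel, elt_one, mul_one]⟩

theorem elt_sr_sq (h : IsPair i w) (k : ZMod 3) : elt i w (.sr k) * elt i w (.sr k) = -1 := by
  simp only [elt]
  rw [mul_assoc, ← mul_assoc _ i, h.pow_val_mul_i, mul_assoc i, ← mul_assoc, h.i_sq,
    ← h.pow_val_add, neg_add_cancel]
  simp

variable {σ : F →+* ℝ}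

theorem w_not_scalar (h : IsPair i w) (σ : F →+* ℝ) (r : F) : w ≠ algebraMap F _ r := by
  rintro rfl
  have h1 := h.w_sq
  rw [← map_mul, ← map_add, ← map_one (algebraMap F ℍ[F, A, B]), ← map_add,
    ← map_zero (algebraMap F ℍ[F, A, B])] at h1
  have h2 := congrArg σ (algebraMap_inj' h1)
  simp only [map_add, map_mul, map_one, map_zero] at h2
  nlinarith [sq_nonneg (σ r + 1 / 2)]

theorem eq_one_of_scalar (h : IsPair i w) (σ : F →+* ℝ) {g : DihedralGroup 3} {r : F}
    (hg : elt i w g = algebraMap F _ r) : g = 1 := by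
  rcases g with k | k
  · fin_cases k
    · rfl
    · exact (h.w_not_scalar σ r ((pow_one w).symm.trans hg)).elim
    · have h1 : w ^ 2 = algebraMap F _ r := hg
      have h2 := h.w_sq
      rw [← pow_two, h1] at h2
      refine (h.w_not_scalar σ (-r - 1) ?_).elim
      rw [map_sub, map_neg, map_one]
      rw [eq_sub_iff_add_eq, eq_neg_iff_add_eq_zero, ← h2]; abel
  · have h1 := h.elt_sr_sq k
    rw [hg, ← map_mul, ← map_one (algebraMap F ℍ[F, A, B]), ← map_neg] at h1
    have h2 := congrArg σ (algebraMap_inj' h1)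
    simp only [map_mul, map_neg, map_one] at h2
    nlinarith [sq_nonneg (σ r)]

theorem elt_unique (h : IsPair i w) (σ : F →+* ℝ) {g g' : DihedralGroup 3} {c c' : F} (hc : c ≠ 0)
    (hg : algebraMap F _ c * elt i w g = algebraMap F _ c' * elt i w g') : g = g' := by
  obtain ⟨e, he, h1⟩ := h.elt_mul_inv g'
  obtain ⟨e', he', h2⟩ := h.elt_mul g g'⁻¹
  have he0 : (e' : F) ≠ 0 := by
    intro h0
    have : e' = 0 := by exact_mod_cast h0
    rw [this] at he'; simp at he'
  have h3 := congrArg (· * elt i w g'⁻¹) hg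
  simp only [mul_assoc, h1, h2] at h3
  have h4 : elt i w (g * g'⁻¹) = algebraMap F _ ((c * e')⁻¹ * (c' * e)) := by
    rw [map_mul, map_mul, ← h3, ← mul_assoc (algebraMap F _ c), ← map_mul, ← mul_assoc, ← map_mul,
      inv_mul_cancel₀ (mul_ne_zero hc he0), map_one, one_mul]
  exact mul_inv_eq_one.1 (h.eq_one_of_scalar σ h4)

variable {O : Subring ℍ[F, A, B]}

theorem elt_mem (hi : i ∈ O) (hw : w ∈ O) (g : DihedralGroup 3) : elt i w g ∈ O := by
  rcases g with k | k
  · exact O.pow_mem hw _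
  · exact O.mul_mem hi (O.pow_mem hw _)

theorem exists_unit (h : IsPair i w) (hi : i ∈ O) (hw : w ∈ O) (g : DihedralGroup 3) :
    ∃ u : (↥O)ˣ, ((u : ↥O) : ℍ[F, A, B]) = elt i w g := by
  obtain ⟨e, he, h1⟩ := h.elt_mul_inv g
  obtain ⟨e', he', h2⟩ := h.elt_mul_inv g⁻¹
  rw [inv_inv] at h2
  have hF : (e : F) * e = 1 := by exact_mod_cast he
  have hF' : (e' : F) * e' = 1 := by exact_mod_cast he'
  have hcast : ∀ e : ℤ, algebraMap F ℍ[F, A, B] (e : F) = (e : ℍ[F, A, B]) :=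
    fun e => map_intCast _ e
  have hee : (e : ℍ[F, A, B]) * e = 1 := by exact_mod_cast congrArg (Int.cast : ℤ → ℍ[F, A, B]) he
  have hee' : (e' : ℍ[F, A, B]) * e' = 1 := by
    exact_mod_cast congrArg (Int.cast : ℤ → ℍ[F, A, B]) he'
  rw [hcast] at h1 h2
  let a : O := ⟨_, elt_mem hi hw g⟩
  let b : O := ⟨_, elt_mem hi hw g⁻¹⟩
  have hab : a * (b * (e : O)) = 1 := by
    apply Subtype.ext
    change elt i w g * (elt i w g⁻¹ * ((e : O) : ℍ[F, A, B])) = 1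
    rw [← mul_assoc, h1, Subring.coe_intCast]; exact hee
  have hba : ((e' : O) * b) * a = 1 := by
    apply Subtype.ext
    change ((e' : O) : ℍ[F, A, B]) * elt i w g⁻¹ * elt i w g = 1
    rw [mul_assoc, h2, Subring.coe_intCast]; exact hee'
  refine ⟨⟨a, b * (e : O), hab, ?_⟩, rfl⟩
  rwa [← left_inv_eq_right_inv hba hab]

theorem firstKind_of_units (h : IsPair i w) (hA : σ A < 0) (hB : σ B < 0) (hO : IsOrder F O)
    (hi : i ∈ O) (hw : w ∈ O)
    (hu : ∀ u : (↥O)ˣ, ∃ c : F, ∃ g, ((u : ↥O) : ℍ[F, A, B]) = algebraMap F _ c * elt i w g) :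
    RedUnitDihedralFirstKind F 3 O := by
  choose c φ hφ using hu
  have hc : ∀ u, c u ≠ 0 := by
    intro u h0
    have h1 := coe_mul_inv u
    rw [hφ, h0, map_zero, zero_mul, zero_mul] at h1
    exact zero_ne_one h1
  have huniq : ∀ (u : (↥O)ˣ) c' g,
      ((u : ↥O) : ℍ[F, A, B]) = algebraMap F _ c' * elt i w g → φ u = g :=
    fun u c' g hg => h.elt_unique σ (hc u) ((hφ u).symm.trans hg)
  refine ⟨MonoidHom.mk' φ ?_, ?_, ?_, ?_⟩
  · intro u v
    obtain ⟨e, -, he⟩ := h.elt_mul (φ u) (φ v)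
    refine huniq (u * v) (c u * c v * e) _ ?_
    rw [Units.val_mul, Subring.coe_mul, hφ u, hφ v, map_mul, map_mul, mul_assoc _ _ (elt i w _),
      ← he,
      mul_assoc, ← mul_assoc (elt i w _), ← Algebra.commutes (c v)]
    simp only [mul_assoc]
  · intro g
    obtain ⟨u, hu⟩ := h.exists_unit hi hw g
    exact ⟨u, huniq u 1 g (by rw [hu, map_one, one_mul])⟩
  · intro u
    constructor
    · intro h1
      refine hO.isScalarUnit (r := c u) ?_
      have h1 : φ u = 1 := h1
      rw [hφ u, h1, elt_one, mul_one]
    · rintro ⟨r, hr⟩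
      refine huniq u (algebraMap (𝓞 F) F r) 1 ?_
      rw [hr, elt_one, mul_one]
  · intro u h1 h2
    have key : ∀ g : DihedralGroup 3, g ≠ 1 → g * g = 1 → ∃ k, g = .sr k := by decide
    obtain ⟨k, hk⟩ := key _ h1 h2
    obtain ⟨u', hu'⟩ := h.exists_unit hi hw (.sr k)
    refine ⟨u', ?_, 1, ?_⟩
    · rw [hk]
      exact huniq u' 1 _ (by rw [hu', map_one, one_mul])
    · rw [hu', redNorm_eq_one_of_sq hA hB (h.elt_sr_sq k)]
      simp

end IsPair

end Dihedral

section Splitting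

variable {A B : F} {i w : ℍ[F, A, B]}

/-- The quaternion basis of `(-1,-3)` attached to a pair. -/
def IsPair.basis (h : IsPair i w) : QuaternionAlgebra.Basis ℍ[F, A, B] (-1 : F) 0 (-3) where
  i := i
  j := 2 * w + 1
  k := i * (2 * w + 1)
  i_mul_i := by rw [h.i_sq, zero_smul, add_zero, neg_one_smul]
  j_mul_j := by
    have : (2 * w + 1) * (2 * w + 1) = 4 * (w * w + w + 1) - 3 := by
      noncomm_ring; norm_num
    rw [this, h.w_sq, mul_zero, zero_sub, neg_smul, ofNat_smul_eq_nsmul, nsmul_one]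
    norm_num
  i_mul_j := rfl
  j_mul_i := by
    have h1 : w * w = -w - 1 := by
      rw [eq_sub_iff_add_eq, eq_neg_iff_add_eq_zero, ← h.w_sq]; abel
    have h2 : i * w = -(w * i) - i := by
      rw [h.comm, h1]; noncomm_ring
    rw [zero_smul, zero_sub, mul_add, mul_one]
    have h3 : i * (2 * w) = 2 * (i * w) := by noncomm_ring
    rw [h3, h2]; noncomm_ring

theorem IsPair.exists_equiv (h : IsPair i w) (σ : F →+* ℝ) :
    ∃ e : ℍ[F, -1, -3] ≃ₐ[F] ℍ[F, A, B], e iQ = i ∧ e wQ = w := by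
  let f := h.basis.liftHom
  have hinj : Function.Injective f := by
    rw [injective_iff_map_eq_zero]
    intro x hx
    by_contra hx0
    have h1 : IsUnit x := isUnit_of_ne_zero (σ := σ) (by simp)
      (by rw [map_neg, map_ofNat]; norm_num) hx0
    have h2 := h1.map f
    rw [hx, isUnit_zero_iff] at h2
    exact zero_ne_one h2
  have hbij : Function.Bijective f := by
    refine ⟨hinj, ?_⟩
    refine (LinearMap.injective_iff_surjective_of_finrank_eq_finrank (f := f.toLinearMap) ?_).1 hinj
    rw [QuaternionAlgebra.finrank_eq_four, QuaternionAlgebra.finrank_eq_four]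
  refine ⟨AlgEquiv.ofBijective f hbij, ?_, ?_⟩
  · change h.basis.lift iQ = i
    simp [QuaternionAlgebra.Basis.lift, iQ, IsPair.basis]
  · change h.basis.lift wQ = w
    simp only [QuaternionAlgebra.Basis.lift, wQ, IsPair.basis, zero_smul, add_zero]
    have h2 : (2 : ℍ[F, A, B]) * w = (2 : F) • w := by
      rw [Algebra.smul_def, map_ofNat]
    rw [h2, smul_add, smul_smul, one_div, inv_mul_cancel₀ two_ne_zero, one_smul,
      Algebra.smul_def, mul_one, ← add_assoc, add_right_comm, ← map_add]
    norm_num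

end Splitting

section Transfer

variable {H H' : Type} [Ring H] [Algebra F H] [Ring H'] [Algebra F H']

/-- The image of a subring under an isomorphism. -/
def tr (e : H ≃ₐ[F] H') (O : Subring H) : Subring H' := O.comap (e.symm : H' →+* H)

theorem mem_tr {e : H ≃ₐ[F] H'} {O : Subring H} {x : H'} : x ∈ tr e O ↔ e.symm x ∈ O := Iff.rfl

theorem IsOrder.tr {O : Subring H} (hO : IsOrder F O) (e : H ≃ₐ[F] H') : IsOrder F (tr e O) := by
  refine ⟨?_, ?_, ?_⟩
  · rintro _ ⟨r, rfl⟩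
    change e.symm _ ∈ O
    rw [AlgEquiv.commutes]
    exact hO.1 ⟨r, rfl⟩
  · have : (QuatPaper.tr e O).toAddSubgroup =
      O.toAddSubgroup.map (e : H →+* H').toAddMonoidHom := by
      ext x
      rw [AddSubgroup.mem_map]
      constructor
      · exact fun hx => ⟨e.symm x, hx, e.apply_symm_apply x⟩
      · rintro ⟨y, hy, rfl⟩
        change e.symm (e y) ∈ O
        rwa [AlgEquiv.symm_apply_apply]
    obtain ⟨S, hS⟩ := hO.2.1
    classical
    refine ⟨S.image e, ?_⟩
    rw [this, ← hS, AddMonoidHom.map_closure, Finset.coe_image]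
    rfl
  · rw [eq_top_iff]
    rintro x -
    have hx : e.symm x ∈ Submodule.span F (O : Set H) := by rw [hO.2.2]; trivial
    have h2 := Submodule.mem_map_of_mem (f := e.toLinearMap) hx
    rw [Submodule.map_span] at h2
    have h3 : e.toLinearMap (e.symm x) = x := e.apply_symm_apply x
    rw [h3] at h2
    refine Submodule.span_mono ?_ h2
    rintro _ ⟨y, hy, rfl⟩
    change e.symm (e y) ∈ O
    rwa [AlgEquiv.symm_apply_apply]

theorem IsMaximalOrder.tr {O : Subring H} (hO : IsMaximalOrder F O) (e : H ≃ₐ[F] H') :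
    IsMaximalOrder F (tr e O) := by
  refine ⟨hO.1.tr e, fun O' hO' hle => ?_⟩
  have h1 : QuatPaper.tr e.symm O' = O := by
    refine hO.2 _ (hO'.tr e.symm) fun x hx => ?_
    refine hle (?_ : e.symm (e x) ∈ O)
    rwa [AlgEquiv.symm_apply_apply]
  rw [← h1]
  ext x
  change x ∈ O' ↔ e (e.symm x) ∈ O'
  rw [AlgEquiv.apply_symm_apply]

/-- Conjugation by `j` as an automorphism. -/
def jconjEquiv : ℍ[F, -1, -3] ≃ₐ[F] ℍ[F, -1, -3] where
  toFun := jconj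
  invFun := jconj
  left_inv := jconj_jconj
  right_inv := jconj_jconj
  map_mul' x y := by ext <;> simp [jconj] <;> ring
  map_add' x y := by ext <;> simp [jconj] <;> ring
  commutes' r := by ext <;> simp [jconj, QuaternionAlgebra.algebraMap_eq]

/-- The averaging construction of the Skolem–Noether theorem for quaternion algebras. -/
theorem skolemNoether_aux {a b a' b' z : H} (ha : a * a = -1) (hb : b * b = -3)
    (hab : b * a = -(a * b)) (ha' : a' * a' = -1) (hb' : b' * b' = -3)
    (hab' : b' * a' = -(a' * b')) :
    let Y := 3 * z - 3 * (a' * z * a) - b' * z * b - a' * b' * z * (a * b)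
    a' * Y = Y * a ∧ b' * Y = Y * b := by
  have haa : ∀ x, a * (a * x) = -x := fun x => by rw [← mul_assoc, ha, neg_one_mul]
  have haa' : ∀ x, a' * (a' * x) = -x := fun x => by rw [← mul_assoc, ha', neg_one_mul]
  have hbb' : ∀ x, b' * (b' * x) = -3 * x := fun x => by rw [← mul_assoc, hb']
  have hba' : ∀ x, b' * (a' * x) = -(a' * (b' * x)) := fun x => by
    rw [← mul_assoc, hab', neg_mul, mul_assoc]
  have h3 : ∀ x y : H, x * (3 * y) = 3 * (x * y) := fun x y => by noncomm_ring
  have h3' : ∀ x : H, x * 3 = 3 * x := fun x => by noncomm_ring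
  constructor <;>
  · simp only [mul_assoc, mul_sub, sub_mul, ha, hb, hab, haa, haa', hbb', hba', h3, h3',
      mul_neg, neg_mul, mul_one]
    noncomm_ring

theorem skolemNoether_sum {a b a' b' : H} (ha : a * a = -1) (hb : b * b = -3)
    (hab : b * a = -(a * b)) :
    let Y := fun z => 3 * z - 3 * (a' * z * a) - b' * z * b - a' * b' * z * (a * b)
    3 * Y 1 - 3 * (Y a * a) - Y b * b - Y (a * b) * (a * b) = 36 := by
  have haa : ∀ x, a * (a * x) = -x := fun x => by rw [← mul_assoc, ha, neg_one_mul]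
  have hba : ∀ x, b * (a * x) = -(a * (b * x)) := fun x => by
    rw [← mul_assoc, hab, neg_mul, mul_assoc]
  have h3 : ∀ x y : H, x * (3 * y) = 3 * (x * y) := fun x y => by noncomm_ring
  have h3' : ∀ x : H, x * 3 = 3 * x := fun x => by noncomm_ring
  simp only [mul_assoc, mul_sub, sub_mul, ha, hb, hab, haa, hba, h3, h3',
    mul_neg, neg_mul, mul_one, neg_neg]
  noncomm_ring
  norm_num

theorem exists_intertwiner {a b a' b' : H} (ha : a * a = -1) (hb : b * b = -3)
    (hab : b * a = -(a * b)) (ha' : a' * a' = -1) (hb' : b' * b' = -3)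
    (hab' : b' * a' = -(a' * b')) (h36 : (36 : H) ≠ 0) :
    ∃ y : H, y ≠ 0 ∧ a' * y = y * a ∧ b' * y = y * b := by
  by_contra! h0
  have h1 : ∀ z, 3 * z - 3 * (a' * z * a) - b' * z * b - a' * b' * z * (a * b) = 0 := by
    intro z
    by_contra hz
    obtain ⟨h2, h3⟩ := skolemNoether_aux (z := z) ha hb hab ha' hb' hab'
    exact h0 _ hz h2 h3
  have h2 := skolemNoether_sum (a' := a') (b' := b') ha hb hab
  simp only [h1, mul_zero, zero_mul, sub_zero] at h2
  exact h36 h2.symm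

theorem exists_conj_equiv {A B : F} (σ : F →+* ℝ) (hA : σ A < 0) (hB : σ B < 0)
    (e e' : ℍ[F, -1, -3] ≃ₐ[F] ℍ[F, A, B]) :
    ∃ X : (ℍ[F, A, B])ˣ, ∀ q,
      (X : ℍ[F, A, B]) * e q * ((X⁻¹ : (ℍ[F, A, B])ˣ) : ℍ[F, A, B]) = e' q := by
  let jQ : ℍ[F, -1, -3] := ⟨0, 0, 1, 0⟩
  have hi : (iQ : ℍ[F, -1, -3]) * iQ = -1 := iQ_sq
  have hj : jQ * jQ = -3 := by
    rw [← map_ofNat (algebraMap F ℍ[F, -1, -3]) 3]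
    ext <;> simp [jQ, QuaternionAlgebra.algebraMap_eq]
  have hij : jQ * iQ = -(iQ * jQ) := by ext <;> simp [jQ, iQ]
  have rel : ∀ f : ℍ[F, -1, -3] ≃ₐ[F] ℍ[F, A, B], f iQ * f iQ = -1 ∧ f jQ * f jQ = -3 ∧
      f jQ * f iQ = -(f iQ * f jQ) := by
    intro f
    rw [← map_mul, hi, ← map_mul, hj, ← map_mul, hij, ← map_mul, map_neg, map_neg, map_neg,
      map_one, map_ofNat]
    exact ⟨rfl, rfl, rfl⟩
  obtain ⟨ha, hb, hab⟩ := rel e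
  obtain ⟨ha', hb', hab'⟩ := rel e'
  generalize haQ : e iQ = a at ha hab
  generalize hbQ : e jQ = b at hb hab
  generalize haQ' : e' iQ = a' at ha' hab'
  generalize hbQ' : e' jQ = b' at hb' hab'
  have h36 : (36 : ℍ[F, A, B]) ≠ 0 := by
    intro h
    rw [← map_ofNat (algebraMap F ℍ[F, A, B]) 36, map_eq_zero_iff _
      (algebraMap F ℍ[F, A, B]).injective] at h
    norm_num at h
  obtain ⟨y, hy, hya, hyb⟩ := exists_intertwiner ha hb hab ha' hb' hab' h36
  obtain ⟨X, hX⟩ := isUnit_of_ne_zero hA hB hy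
  refine ⟨X, fun q => ?_⟩
  rw [Units.mul_inv_eq_iff_eq_mul, hX]
  have hq : q = algebraMap F _ q.re + algebraMap F _ q.imI * iQ + algebraMap F _ q.imJ * jQ
      + algebraMap F _ q.imK * (iQ * jQ) := by
    ext <;> simp [iQ, jQ, QuaternionAlgebra.algebraMap_eq]
  rw [hq]
  have hc : ∀ (r : F) (x x1 : ℍ[F, A, B]), y * x = x1 * y →
      y * (algebraMap F _ r * x) = algebraMap F _ r * x1 * y := by
    intro r x x1 h
    rw [← mul_assoc, ← Algebra.commutes, mul_assoc, h, mul_assoc]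
  have hab2 : y * (a * b) = a' * b' * y := by
    rw [← mul_assoc, ← hya, mul_assoc, ← hyb, mul_assoc]
  simp only [map_add, map_mul, AlgEquiv.commutes, mul_add, add_mul, haQ, hbQ, haQ', hbQ']
  rw [hc _ _ _ hya.symm, hc _ _ _ hyb.symm, hc _ _ _ hab2, Algebra.commutes q.re y]

end Transfer

section FirstKind

variable {A B : F} {O : Subring ℍ[F, A, B]} {σ : F →+* ℝ}

theorem exists_scalar_of_map_eq {G : Type*} [Group G] {φ : (↥O)ˣ →* G}
    (hφ : ∀ u, φ u = 1 ↔ IsScalarUnit F u) {x y : (↥O)ˣ} (h : φ x = φ y) :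
    ∃ t : (𝓞 F)ˣ, ((x : ↥O) : ℍ[F, A, B]) =
      algebraMap F _ (algebraMap (𝓞 F) F ↑t) * ((y : ↥O) : ℍ[F, A, B]) := by
  have h1 : φ (x * y⁻¹) = 1 := by rw [map_mul, map_inv, h, mul_inv_cancel]
  obtain ⟨t, ht⟩ := (hφ _).1 h1
  refine ⟨t, ?_⟩
  rw [← ht, ← Subring.coe_mul, ← Units.val_mul, inv_mul_cancel_right]

/-- A pure unit with square reduced norm rescales to a square root of `-1`. -/
theorem exists_sq_neg_one (hO : IsOrder F O) {u : (↥O)ˣ} (hns : ¬IsScalarUnit F u)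
    (hsq : IsScalarUnit F (u * u)) {r : (𝓞 F)ˣ}
    (hr : redNorm F ((u : ↥O) : ℍ[F, A, B]) = algebraMap (𝓞 F) F ↑r ^ 2) :
    ∃ a : F, a ≠ 0 ∧ algebraMap F _ a * ((u : ↥O) : ℍ[F, A, B]) ∈ O ∧
      (algebraMap F _ a * ((u : ↥O) : ℍ[F, A, B])) *
        (algebraMap F _ a * ((u : ↥O) : ℍ[F, A, B])) = -1 := by
  obtain ⟨c, hc⟩ := hsq
  rw [Units.val_mul, Subring.coe_mul] at hc
  have hr0 : algebraMap (𝓞 F) F ↑r ≠ 0 := by simp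
  have hmem := (u : ↥O).2
  have hs : ∀ q : F, ((u : ↥O) : ℍ[F, A, B]) ≠ algebraMap F _ q :=
    fun q hq => hns (hO.isScalarUnit hq)
  generalize ((u : ↥O) : ℍ[F, A, B]) = x at *
  rw [mul_self_eq] at hc
  have hre : x.re = 0 := by
    by_contra hre
    refine hs ((2 * x.re)⁻¹ * (algebraMap (𝓞 F) F ↑c + redNorm F x)) ?_
    rw [map_mul, map_add, ← hc, sub_add_cancel, ← mul_assoc, ← map_mul,
      inv_mul_cancel₀ (mul_ne_zero two_ne_zero hre), map_one, one_mul]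
  refine ⟨algebraMap (𝓞 F) F ↑r⁻¹, by simp, ?_, ?_⟩
  · exact O.mul_mem (hO.algebraMap_mem (RingOfIntegers.isIntegral_coe _)) hmem
  · have h1 : algebraMap (𝓞 F) F ↑r⁻¹ * algebraMap (𝓞 F) F ↑r = 1 := by
      rw [← map_mul, Units.inv_mul, map_one]
    have h2 : x * x = -algebraMap F _ (redNorm F x) := by
      rw [mul_self_eq, hre, mul_zero, map_zero, zero_mul, zero_sub]
    generalize algebraMap (𝓞 F) F ↑r⁻¹ = b at *
    rw [mul_assoc, ← mul_assoc x, ← Algebra.commutes b x, mul_assoc, h2, ← mul_assoc, ← map_mul,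
      mul_neg, ← map_mul, hr, show b * b * algebraMap (𝓞 F) F ↑r ^ 2
        = (b * algebraMap (𝓞 F) F ↑r) ^ 2 by ring, h1, one_pow, map_one]

/-- A unit with scalar cube rescales to a primitive cube root of unity. -/
theorem exists_cube_root (hA : σ A < 0) (hB : σ B < 0) (hO : IsOrder F O) {v : (↥O)ˣ}
    (hns : ¬IsScalarUnit F v) (h3 : IsScalarUnit F (v * v * v)) :
    ∃ b : F, b ≠ 0 ∧ algebraMap F _ b * ((v : ↥O) : ℍ[F, A, B]) ∈ O ∧
      (algebraMap F _ b * ((v : ↥O) : ℍ[F, A, B])) * (algebraMap F _ b * ((v : ↥O) : ℍ[F, A, B]))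
        + algebraMap F _ b * ((v : ↥O) : ℍ[F, A, B]) + 1 = 0 := by
  obtain ⟨t, ht⟩ := h3
  rw [Units.val_mul, Units.val_mul, Subring.coe_mul, Subring.coe_mul] at ht
  have hmem := (v : ↥O).2
  have hmem' := ((v⁻¹ : (↥O)ˣ) : ↥O).2
  have hvv := coe_mul_inv v
  have hs : ∀ q : F, ((v : ↥O) : ℍ[F, A, B]) ≠ algebraMap F _ q :=
    fun q hq => hns (hO.isScalarUnit hq)
  have hc0 : algebraMap (𝓞 F) F ↑t ≠ 0 := by simp
  generalize ((v : ↥O) : ℍ[F, A, B]) = x at *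
  generalize (((v⁻¹ : (↥O)ˣ) : ↥O) : ℍ[F, A, B]) = y at *
  generalize algebraMap (𝓞 F) F ↑t = c at *
  have hn1 : redNorm F x * redNorm F y = 1 := by rw [← redNorm_mul, hvv, redNorm_one]
  have hn3 : redNorm F x * redNorm F x * redNorm F x = c ^ 2 := by
    rw [← redNorm_mul, ← redNorm_mul, ht, redNorm_algebraMap]
  have hny := hO.redNorm_integral hmem'
  generalize redNorm F x = n at *
  generalize redNorm F y = m at *
  have hn0 : n ≠ 0 := left_ne_zero_of_mul_eq_one hn1
  have hb0 : n / c ≠ 0 := div_ne_zero hn0 hc0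
  have hb2 : (n / c) ^ 2 = m := by
    rw [div_pow, ← hn3]
    field_simp
    linear_combination -hn1
  have hb : IsIntegral ℤ (n / c) := IsIntegral.of_pow two_pos (hb2 ▸ hny)
  have hbc : (n / c) * (n / c) * (n / c) * c = 1 := by
    field_simp
    linear_combination hn3
  generalize n / c = b at *
  refine ⟨b, hb0, O.mul_mem (hO.algebraMap_mem hb) hmem, ?_⟩
  have hcomm : ∀ z : ℍ[F, A, B], z * algebraMap F _ b = algebraMap F _ b * z := fun z =>
    (Algebra.commutes b z).symm
  have hw1 : algebraMap F _ b * x - 1 ≠ 0 := by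
    intro h
    refine hs b⁻¹ ?_
    rw [sub_eq_zero] at h
    rw [← mul_one (algebraMap F ℍ[F, A, B] b⁻¹), ← h, ← mul_assoc, ← map_mul,
      inv_mul_cancel₀ hb0, map_one, one_mul]
  have hw3 : (algebraMap F _ b * x) * (algebraMap F _ b * x) * (algebraMap F _ b * x) = 1 := by
    have : (algebraMap F _ b * x) * (algebraMap F _ b * x) * (algebraMap F _ b * x)
        = algebraMap F _ b * algebraMap F _ b * algebraMap F _ b * (x * x * x) := by
      simp only [mul_assoc]
      rw [← mul_assoc x (algebraMap F _ b), hcomm x, ← mul_assoc x (algebraMap F _ b), hcomm x]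
      simp only [mul_assoc]
      rw [← mul_assoc x (algebraMap F _ b), hcomm x]
      simp only [mul_assoc]
    rw [this, ht, ← map_mul, ← map_mul, ← map_mul, hbc, map_one]
  refine (mul_eq_zero_of_definite hA hB (?_ : (algebraMap F _ b * x - 1) * _ = 0)).resolve_left hw1
  rw [← sub_eq_zero] at hw3
  rw [← hw3]
  noncomm_ring

theorem eq_one_of_twisted_comm (σ : F →+* ℝ) {i w : ℍ[F, A, B]} {s : F} (hi : i * i = -1)
    (hw : w * (w * w) = 1) (h : i * w = s • (w * w * i)) : s = 1 := by
  have h2 : i * w * w = (s * s) • (w * i) := by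
    rw [h, smul_mul_assoc, mul_assoc, h, mul_smul_comm, smul_smul]
    congr 1
    rw [mul_assoc w w, ← mul_assoc w (w * w) i, hw, one_mul]
  have h3 : i * w * w * w = (s * s * s) • i := by
    rw [h2, smul_mul_assoc, mul_assoc, h, mul_smul_comm, smul_smul, ← mul_assoc w, hw, one_mul]
  have h4 : i * w * w * w = i := by rw [mul_assoc, mul_assoc, hw, mul_one]
  rw [h4] at h3
  have h5 : i * i = (s * s * s) • (i * i) := by
    rw [← smul_mul_assoc, ← h3]
  have h6 : s * s * s = 1 := by
    rw [hi, Algebra.smul_def, mul_neg, mul_one, neg_inj,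
      ← map_one (algebraMap F ℍ[F, A, B])] at h5
    exact (algebraMap_inj' h5).symm
  have h7 : σ s ^ 3 = 1 := by rw [← map_pow, ← map_one σ, ← h6]; congr 1; ring
  have h8 : σ s = 1 := by
    have : (σ s - 1) * (σ s ^ 2 + σ s + 1) = 0 := by linear_combination h7
    rcases mul_eq_zero.1 this with h | h
    · linarith
    · nlinarith [sq_nonneg (σ s + 1 / 2)]
  exact σ.injective (h8.trans (map_one σ).symm)

theorem exists_pair_of_firstKind (hA : σ A < 0) (hB : σ B < 0) (hO : IsOrder F O)
    (h : RedUnitDihedralFirstKind F 3 O) : ∃ i w : ℍ[F, A, B], i ∈ O ∧ w ∈ O ∧ IsPair i w := by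
  obtain ⟨φ, hsurj, hφ, hfk⟩ := h
  obtain ⟨u₀, hu₀⟩ := hsurj (.sr 0)
  obtain ⟨u, hu, r, hr⟩ := hfk u₀ (by rw [hu₀]; decide) (by rw [hu₀]; decide)
  obtain ⟨v, hv⟩ := hsurj (.r 1)
  rw [hu₀] at hu
  obtain ⟨a, ha0, haO, ha⟩ := exists_sq_neg_one hO (u := u) (by rw [← hφ, hu]; decide)
    (by rw [← hφ, map_mul, hu]; decide) hr
  obtain ⟨b, hb0, hbO, hb⟩ := exists_cube_root hA hB hO (v := v) (by rw [← hφ, hv]; decide)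
    (by rw [← hφ, map_mul, map_mul, hv]; decide)
  obtain ⟨t, ht⟩ := exists_scalar_of_map_eq hφ (x := u * v) (y := v * v * u)
    (by rw [map_mul, map_mul, map_mul, hu, hv]; decide)
  refine ⟨_, _, haO, hbO, ha, hb, ?_⟩
  simp only [Units.val_mul, Subring.coe_mul] at ht
  generalize ((u : ↥O) : ℍ[F, A, B]) = x at *
  generalize ((v : ↥O) : ℍ[F, A, B]) = y at *
  generalize algebraMap (𝓞 F) F ↑t = c at *
  simp only [← Algebra.smul_def] at *
  have h1 : (a • x) * (b • y) = (c / b) • ((b • y) * (b • y) * (a • x)) := by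
    simp only [smul_mul_smul_comm, smul_smul, ht]
    congr 1
    field_simp
  have hw3 : (b • y) * ((b • y) * (b • y)) = 1 := by
    have (w : ℍ[F, A, B]) : w * (w * w) - 1 = (w - 1) * (w * w + w + 1) := by noncomm_ring
    rw [← sub_eq_zero, this, hb, mul_zero]
  rw [eq_one_of_twisted_comm σ ha hw3 h1, one_smul] at h1
  exact h1

/-- If the reduced unit group is `D₃`, no noncentral unit with scalar square commutes with `w`. -/
theorem not_commuting_unit {i w : ℍ[F, A, B]} (h : RedUnitDihedralFirstKind F 3 O)
    (hp : IsPair i w) (σ : F →+* ℝ) (hi : i ∈ O) (hw : w ∈ O)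
    (z : (↥O)ˣ) (hz : ¬IsScalarUnit F z) (hz2 : IsScalarUnit F (z * z))
    (hcomm : ((z : ↥O) : ℍ[F, A, B]) * w = w * ((z : ↥O) : ℍ[F, A, B])) : False := by
  obtain ⟨φ, -, hφ, -⟩ := h
  obtain ⟨W, hW⟩ := hp.exists_unit hi hw (.r 1)
  have hW' : ((W : ↥O) : ℍ[F, A, B]) = w := by
    rw [hW]; exact pow_one w
  have key : ∀ a b : DihedralGroup 3, a ≠ 1 → a * a * a = 1 → b ≠ 1 → b * b = 1 →
      b * a ≠ a * b := by
    decide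
  refine key (φ W) (φ z) ?_ ?_ ?_ ?_ ?_
  · rw [Ne, hφ]
    rintro ⟨r, hr⟩
    exact hp.w_not_scalar σ _ (hW'.symm.trans hr)
  · rw [← map_mul, ← map_mul, show W * W * W = 1 from ?_, map_one]
    apply Units.ext
    apply Subtype.ext
    simp only [Units.val_mul, Subring.coe_mul, hW', Units.val_one, Subring.coe_one]
    rw [← hp.w_cube, pow_succ, pow_two]
  · rwa [Ne, hφ]
  · rwa [← map_mul, hφ]
  · rw [← map_mul, ← map_mul]
    congr 1
    apply Units.ext
    apply Subtype.ext
    simpa only [Units.val_mul, Subring.coe_mul, hW'] using hcomm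

end FirstKind

section Count

variable {A B : F} {d : ℕ} {s : F} {σ : F →+* ℝ}

theorem isPair_equiv (e : ℍ[F, -1, -3] ≃ₐ[F] ℍ[F, A, B]) : IsPair (e iQ) (e wQ) where
  i_sq := by rw [← map_mul, iQ_sq, map_neg, map_one]
  w_sq := by rw [← map_mul, ← map_add, ← map_one e, ← map_add, wQ_sq, map_zero]
  comm := by rw [← map_mul, iQ_wQ, map_mul, map_mul]

theorem IsRealQuad.firstKind_tr (h : IsRealQuad d s σ) (hA : σ A < 0) (hB : σ B < 0)
    (H3 : ∀ f : F, f ≠ 0 → IsIntegral ℤ (3 * f ^ 2) → IsIntegral ℤ (3 * f ^ 2)⁻¹ → False)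
    {L : Subring ℍ[F, -1, -3]} (hL : IsOrder F L) (hi : iQ ∈ L) (hw : wQ ∈ L)
    (e : ℍ[F, -1, -3] ≃ₐ[F] ℍ[F, A, B]) : RedUnitDihedralFirstKind F 3 (tr e L) := by
  have hp := isPair_equiv e
  refine hp.firstKind_of_units hA hB (hL.tr e) (by rwa [mem_tr, e.symm_apply_apply])
    (by rwa [mem_tr, e.symm_apply_apply]) fun u => ?_
  obtain ⟨c, k, hck⟩ := h.unit_cases hL hi hw H3 (u : ↥(tr e L)).2
    ((u⁻¹ : (↥(tr e L))ˣ) : ↥(tr e L)).2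
    ((map_mul e.symm _ _).symm.trans ((congrArg e.symm (coe_mul_inv u)).trans (map_one e.symm)))
    ((map_mul e.symm _ _).symm.trans ((congrArg e.symm (coe_inv_mul u)).trans (map_one e.symm)))
  have hpow : e wQ ^ ((k : ZMod 3)).val = e wQ ^ k := by
    rw [ZMod.val_natCast, ← pow_eq_pow_mod k hp.w_cube]
  rcases hck with hck | hck
  · refine ⟨c, .r k, ?_⟩
    have := congrArg e hck
    rw [map_mul, e.commutes, map_pow, ← hpow] at this
    exact (e.apply_symm_apply _).symm.trans this
  · refine ⟨c, .sr k, ?_⟩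
    have := congrArg e hck
    rw [map_mul, map_mul, e.commutes, map_pow, ← hpow] at this
    exact (e.apply_symm_apply _).symm.trans this

/-- Every maximal order of the first kind contains a transported copy of the standard generators. -/
theorem exists_equiv_of_firstKind (hA : σ A < 0) (hB : σ B < 0) {O : Subring ℍ[F, A, B]}
    (hO : IsOrder F O) (hfk : RedUnitDihedralFirstKind F 3 O) :
    ∃ e : ℍ[F, -1, -3] ≃ₐ[F] ℍ[F, A, B], e iQ ∈ O ∧ e wQ ∈ O := by
  obtain ⟨i, w, hi, hw, hp⟩ := exists_pair_of_firstKind hA hB hO hfk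
  obtain ⟨e, rfl, rfl⟩ := hp.exists_equiv σ
  exact ⟨e, hi, hw⟩

theorem conjRel_tr (hA : σ A < 0) (hB : σ B < 0) (e e' : ℍ[F, -1, -3] ≃ₐ[F] ℍ[F, A, B])
    (L : Subring ℍ[F, -1, -3]) : ConjRel (tr e L) (tr e' L) := by
  obtain ⟨X, hX⟩ := exists_conj_equiv σ hA hB e e'
  refine ⟨X, fun y => ?_⟩
  have := hX (e.symm y)
  rw [e.apply_symm_apply] at this
  rw [this, mem_tr, mem_tr, e'.symm_apply_apply]

theorem IsRealQuad.not_firstKind (h : IsRealQuad d s σ) (hA : σ A < 0) (hB : σ B < 0)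
    {ε : (𝓞 F)ˣ} {t : F} (ht : 3 * algebraMap (𝓞 F) F ↑ε = t ^ 2) {O : Subring ℍ[F, A, B]}
    (hO : IsMaximalOrder F O) (hfk : RedUnitDihedralFirstKind F 3 O) : False := by
  obtain ⟨e, hi, hw⟩ := exists_equiv_of_firstKind hA hB hO.1 hfk
  obtain ⟨hd, hti, hts⟩ := h.three_dvd_of_sq ht
  have hmax := hO.tr e.symm
  have heq := hmax.2 _ (latt_isOrder (h.good_ramified hd))
    (h.le_latt_ramified hd hmax.1 hi hw)
  have ht0 : t ≠ 0 := by
    rintro rfl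
    have : algebraMap (𝓞 F) F ↑ε ≠ 0 := by simp
    exact this (by linear_combination ht / 3)
  let x : ℍ[F, -1, -3] := ⟨0, 0, -t / 3, 0⟩
  have hx : x ∈ tr e.symm O := by
    rw [← heq, mem_latt]
    have h1 : cp x = 0 := by simp [cp, x]
    have h2 : cp' x = 0 := by simp [cp', x]
    have h3 : cq x = t := by simp only [cq, x]; ring
    have h4 : cq' x = 0 := by simp [cq', x]
    rw [h1, h2, h3, h4, zero_mul, zero_div]
    exact ⟨isIntegral_zero, isIntegral_zero, ⟨hti, hts⟩, isIntegral_zero, isIntegral_zero⟩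
  have hn : redNorm F x = algebraMap (𝓞 F) F ↑ε := by
    rw [redNorm_eq]
    simp only [x]
    linear_combination -ht / 3
  have hε : algebraMap F ℍ[F, -1, -3] (algebraMap (𝓞 F) F ↑ε) *
      algebraMap F _ (algebraMap (𝓞 F) F ↑ε⁻¹) = 1 := by
    rw [← map_mul, ← map_mul, Units.mul_inv, map_one, map_one]
  have hεO : algebraMap F _ (algebraMap (𝓞 F) F ↑ε⁻¹) ∈ tr e.symm O :=
    hmax.1.algebraMap_mem (RingOfIntegers.isIntegral_coe _)
  have hy := (tr e.symm O).mul_mem (hmax.1.star_mem hx) hεO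
  have hxy : x * (star x * algebraMap F _ (algebraMap (𝓞 F) F ↑ε⁻¹)) = 1 := by
    rw [← mul_assoc, mul_star_eq_redNorm, hn, hε]
  have hyx : star x * algebraMap F _ (algebraMap (𝓞 F) F ↑ε⁻¹) * x = 1 := by
    rw [mul_assoc, Algebra.commutes, ← mul_assoc, star_mul_eq_redNorm, hn, hε]
  generalize star x * algebraMap F _ (algebraMap (𝓞 F) F ↑ε⁻¹) = y at *
  let z : (↥O)ˣ := ⟨⟨e x, hx⟩, ⟨e y, hy⟩,
    Subtype.ext ((map_mul e x y).symm.trans ((congrArg e hxy).trans (map_one e))),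
    Subtype.ext ((map_mul e y x).symm.trans ((congrArg e hyx).trans (map_one e)))⟩
  have hxx : x * x = algebraMap F _ (-algebraMap (𝓞 F) F ↑ε) := by
    rw [mul_self_eq, hn]
    simp [x]
  refine not_commuting_unit hfk (isPair_equiv e) σ hi hw z ?_ ?_ ?_
  · rintro ⟨r, hr⟩
    have h1 : e x = e (algebraMap F _ (algebraMap (𝓞 F) F ↑r)) := hr.trans (e.commutes _).symm
    have h2 := congrArg QuaternionAlgebra.imJ (e.injective h1)
    rw [QuaternionAlgebra.algebraMap_eq] at h2
    have h3 : -t / 3 = 0 := h2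
    exact ht0 (by linear_combination -3 * h3)
  · refine hO.1.isScalarUnit (r := -algebraMap (𝓞 F) F ↑ε) ?_
    exact (map_mul e x x).symm.trans ((congrArg e hxx).trans (e.commutes _))
  · change e x * e wQ = e wQ * e x
    rw [← map_mul, ← map_mul]
    congr 1
    ext <;> simp [x, wQ] <;> ring

theorem IsRealQuad.typeNum_eq_one (h : IsRealQuad d s σ) (hA : σ A < 0) (hB : σ B < 0)
    (H3 : ∀ f : F, f ≠ 0 → IsIntegral ℤ (3 * f ^ 2) → IsIntegral ℤ (3 * f ^ 2)⁻¹ → False)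
    (e₀ : ℍ[F, -1, -3] ≃ₐ[F] ℍ[F, A, B]) : typeNumDnFirstKind F A B 3 = 1 := by
  obtain ⟨L, hL, hi, hw, huniq⟩ := h.exists_maximal
  have hall : ∀ O : Subring ℍ[F, A, B], IsMaximalOrder F O → RedUnitDihedralFirstKind F 3 O →
      ∃ e : ℍ[F, -1, -3] ≃ₐ[F] ℍ[F, A, B], tr e L = O := by
    intro O hO hfk
    obtain ⟨e, hei, hew⟩ := exists_equiv_of_firstKind hA hB hO.1 hfk
    rcases huniq _ (hO.tr e.symm) hei hew with hx | hx
    · refine ⟨e, Subring.ext fun y => ?_⟩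
      rw [mem_tr, ← hx, mem_tr, e.symm_symm, e.apply_symm_apply]
    · refine ⟨jconjEquiv.trans e, Subring.ext fun y => ?_⟩
      change jconj (e.symm y) ∈ L ↔ _
      rw [← hx, mem_tr, e.symm_symm, e.apply_symm_apply]
  refine Nat.card_eq_one_iff_unique.2 ⟨⟨?_⟩, ⟨Quot.mk _ ⟨tr e₀ L, hL.tr e₀,
    h.firstKind_tr hA hB H3 hL.1 hi hw e₀⟩⟩⟩
  rintro ⟨O, hO, hfk⟩ ⟨O', hO', hfk'⟩
  obtain ⟨e, he⟩ := hall O hO hfk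
  obtain ⟨e', he'⟩ := hall O' hO' hfk'
  refine Quot.sound ?_
  subst he he'
  exact conjRel_tr hA hB e e' L

end Count

end

/-- **Refined type number for `D₃†`** -/
theorem typeNum_D3_first_kind
    (d : ℕ) (hd6 : 6 ≤ d) (hdsf : Squarefree d)
    (sqrtd : F) (hsqrtd : sqrtd ^ 2 = (d : F))
    (hgen : Algebra.adjoin ℚ {sqrtd} = ⊤)
    (σ₀ : F →+* ℝ) (hσ₀ : 0 < σ₀ sqrtd)
    -- `ε` is the fundamental unit of `F`: the smallest unit greater than `1`
    (ε : (𝓞 F)ˣ) (hε : 1 < σ₀ (algebraMap (𝓞 F) F ↑ε))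
    (hεfund : ∀ u : (𝓞 F)ˣ, 1 < σ₀ (algebraMap (𝓞 F) F ↑u) →
      σ₀ (algebraMap (𝓞 F) F ↑ε) ≤ σ₀ (algebraMap (𝓞 F) F ↑u))
    -- `H = ℍ[F, A, B]` is a totally definite quaternion `F`-algebra (every totally
    -- definite quaternion algebra admits such a presentation)
    (A B : F) (hdef : ∀ σ : F →+* ℝ, σ A < 0 ∧ σ B < 0) :
    (Nonempty (ℍ[F, A, B] ≃ₐ[F] ℍ[F, -1, -3]) ∧
        ¬(∃ t : F, 3 * algebraMap (𝓞 F) F ↑ε = t ^ 2) →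
      typeNumDnFirstKind F A B 3 = 1) ∧
    (¬(Nonempty (ℍ[F, A, B] ≃ₐ[F] ℍ[F, -1, -3]) ∧
        ¬(∃ t : F, 3 * algebraMap (𝓞 F) F ↑ε = t ^ 2)) →
      typeNumDnFirstKind F A B 3 = 0) := by
  have h : IsRealQuad d sqrtd σ₀ := ⟨hd6, hdsf, hsqrtd, hgen, hσ₀⟩
  obtain ⟨hA, hB⟩ := hdef σ₀
  refine ⟨?_, fun hn => ?_⟩
  · rintro ⟨⟨e⟩, hsq⟩
    exact h.typeNum_eq_one hA hB (h.not_unit_three_sq hε hεfund hsq) e.symm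
  · refine Nat.card_eq_zero.2 (Or.inl ⟨?_⟩)
    rintro ⟨O, hO, hfk⟩
    refine hn ⟨?_, ?_⟩
    · obtain ⟨e, -⟩ := exists_equiv_of_firstKind hA hB hO.1 hfk
      exact ⟨e.symm⟩
    · rintro ⟨t, ht⟩
      exact h.not_firstKind hA hB ht hO hfk

end QuatPaper
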